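/- arXiv:1206.5543 — 2 statements merged into one kernel-verified Lean document; each statement's English description precedes it below -/
import Mathlib

section
/- Under assumptions 1–6, the maximizer is unique: if Y ∈ Π satisfies E[h(∫_0^1 Y_t dt)] = ∫_0^1 h(∫_0^1 x_λ(t) dt) dλ, then almost surely the sample path t ↦ Y_t equals t ↦ x_λ(t) for some λ ∈ (0,1), and the law of Y as a random element of C([0,1], ℝ) equals the pushforward of Lebesgue measure on (0,1) under λ ↦ x_λ(·), i.e., the law of X^opt. -/
open MeasureTheory Filter Set

/-- The cumulative distribution function of a measure on `ℝ`. -/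
noncomputable def mCdf (μ : Measure ℝ) (x : ℝ) : ℝ := (μ (Set.Iic x)).toReal

/-- The quantile function (generalized inverse cdf) of a measure on `ℝ`:
`F⁻¹(l) = inf {x | F(x) ≥ l}`. -/
noncomputable def mQuantile (μ : Measure ℝ) (l : ℝ) : ℝ := sInf {x : ℝ | l ≤ mCdf μ x}

/-- The support of a measure on `ℝ`: points all of whose neighbourhoods have
positive measure. -/
def mSupport (μ : Measure ℝ) : Set ℝ := {x : ℝ | ∀ U ∈ nhds x, 0 < μ U}



section quantileFacts

variable (ν : Measure ℝ) [IsProbabilityMeasure ν]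

lemma mCdf_eq_cdf (x : ℝ) : mCdf ν x = ProbabilityTheory.cdf ν x := by
  rw [ProbabilityTheory.cdf_eq_real]; rfl

lemma mCdf_mono : Monotone (mCdf ν) := by
  intro x y hxy
  simp only [mCdf_eq_cdf]
  exact ProbabilityTheory.monotone_cdf ν hxy

lemma mCdf_continuous [NullSingletonClass ν] : Continuous (mCdf ν) := by
  have e : mCdf ν = ProbabilityTheory.cdf ν := funext (mCdf_eq_cdf ν)
  rw [e, continuous_iff_continuousAt]
  intro x
  rw [(ProbabilityTheory.monotone_cdf ν).continuousAt_iff_leftLim_eq_rightLim]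
  have h1 := (ProbabilityTheory.cdf ν).measure_singleton x
  rw [ProbabilityTheory.measure_cdf, measure_singleton] at h1
  have h2 : ProbabilityTheory.cdf ν x ≤ Function.leftLim (ProbabilityTheory.cdf ν) x := by
    have := ENNReal.ofReal_eq_zero.1 h1.symm
    linarith
  rw [StieltjesFunction.rightLim_eq]
  exact le_antisymm ((ProbabilityTheory.monotone_cdf ν).leftLim_le le_rfl) h2

lemma quantile_mem [NullSingletonClass ν] {l : ℝ} (hl : l ∈ Ioo (0:ℝ) 1) :
    IsLeast {x : ℝ | l ≤ mCdf ν x} (mQuantile ν l) := by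
  have hc : IsClosed {x : ℝ | l ≤ mCdf ν x} :=
    isClosed_le continuous_const (mCdf_continuous ν)
  have hne : {x : ℝ | l ≤ mCdf ν x}.Nonempty := by
    have := (ProbabilityTheory.tendsto_cdf_atTop ν).eventually (lt_mem_nhds hl.2)
    obtain ⟨x, hx⟩ := this.exists
    exact ⟨x, by simpa [mCdf_eq_cdf] using hx.le⟩
  have hb : BddBelow {x : ℝ | l ≤ mCdf ν x} := by
    have := (ProbabilityTheory.tendsto_cdf_atBot ν).eventually (gt_mem_nhds hl.1)
    obtain ⟨x, hx⟩ := this.exists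
    refine ⟨x, fun y hy => ?_⟩
    by_contra hlt
    have h1 := mCdf_mono ν (not_le.1 hlt).le
    have hy' : l ≤ mCdf ν y := hy
    rw [← mCdf_eq_cdf] at hx
    linarith
  exact ⟨hc.csInf_mem hne hb, fun y hy => csInf_le hb hy⟩

lemma quantile_le_iff [NullSingletonClass ν] {l : ℝ} (hl : l ∈ Ioo (0:ℝ) 1) (x : ℝ) :
    mQuantile ν l ≤ x ↔ l ≤ mCdf ν x := by
  have h := quantile_mem ν hl
  exact ⟨fun hx => le_trans h.1 (mCdf_mono ν hx), fun hx => h.2 hx⟩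

lemma cdf_quantile [NullSingletonClass ν] {l : ℝ} (hl : l ∈ Ioo (0:ℝ) 1) :
    mCdf ν (mQuantile ν l) = l := by
  refine le_antisymm ?_ (quantile_mem ν hl).1
  have hcw : Tendsto (mCdf ν) (nhdsWithin (mQuantile ν l) (Iio (mQuantile ν l)))
      (nhds (mCdf ν (mQuantile ν l))) := (mCdf_continuous ν).continuousAt.continuousWithinAt
  refine le_of_tendsto hcw ?_
  filter_upwards [self_mem_nhdsWithin] with x hx
  by_contra hlt
  exact absurd ((quantile_le_iff ν hl x).2 (not_le.1 hlt).le) (not_le.2 hx)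

lemma quantile_strictMono [NullSingletonClass ν] : StrictMonoOn (mQuantile ν) (Ioo (0:ℝ) 1) := by
  intro a ha b hb hab
  by_contra hle
  have := mCdf_mono ν (not_lt.1 hle)
  rw [cdf_quantile ν ha, cdf_quantile ν hb] at this
  linarith

lemma lt_cdf_of_quantile_lt [NullSingletonClass ν] (hs : (mSupport ν).OrdConnected) {l : ℝ}
    (hl : l ∈ Ioo (0:ℝ) 1) {x : ℝ} (hx : mQuantile ν l < x) : l < mCdf ν x := by
  by_contra hle
  have e : mCdf ν x = l := le_antisymm (not_lt.1 hle) ((quantile_le_iff ν hl x).1 hx.le)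
  have e0 := cdf_quantile ν hl
  set y := mQuantile ν l with hy
  have hsup : mSupport ν = ν.support := by
    ext z; rw [Measure.mem_support_iff_forall]; rfl
  have hIoc : ν (Ioc y x) = 0 := by
    have : Ioc y x = Iic x \ Iic y := by ext z; simp [and_comm]
    rw [this, measure_sdiff (Iic_subset_Iic.2 hx.le) measurableSet_Iic.nullMeasurableSet
      (measure_ne_top _ _)]
    have : ν (Iic x) = ν (Iic y) := by
      have : (ν (Iic x)).toReal = (ν (Iic y)).toReal := e.trans e0.symm
      exact (ENNReal.toReal_eq_toReal_iff' (measure_ne_top _ _) (measure_ne_top _ _)).1 this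
    rw [this, tsub_self]
  have p1 : 0 < ν (Iic y) := by
    by_contra h0
    have : ν (Iic y) = 0 := by simpa using h0
    have : mCdf ν y = 0 := by simp [mCdf, this]
    linarith [hl.1]
  have p2 : 0 < ν (Ioi x) := by
    have h1 := prob_add_prob_compl (μ := ν) (s := Iic x) measurableSet_Iic
    rw [compl_Iic] at h1
    by_contra h0
    have h0' : ν (Ioi x) = 0 := by simpa using h0
    rw [h0', add_zero] at h1
    have : mCdf ν x = 1 := by simp [mCdf, h1]
    linarith [hl.2]
  obtain ⟨a, ha, ha'⟩ := Measure.nonempty_inter_support_of_pos p1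
  obtain ⟨b, hb, hb'⟩ := Measure.nonempty_inter_support_of_pos p2
  rw [← hsup] at ha' hb'
  have hm : (y + x) / 2 ∈ mSupport ν := by
    refine hs.out ha' hb' ⟨?_, ?_⟩
    · have : a ≤ y := ha
      linarith
    · have : x < b := hb
      linarith
  have := hm (Ioo y x) (Ioo_mem_nhds (by linarith) (by linarith))
  exact absurd (measure_mono_null Ioo_subset_Ioc_self hIoc) this.ne'

lemma quantile_continuousOn [NullSingletonClass ν] (hs : (mSupport ν).OrdConnected) :
    ContinuousOn (mQuantile ν) (Ioo (0:ℝ) 1) := by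
  intro l hl
  apply ContinuousAt.continuousWithinAt
  rw [ContinuousAt, tendsto_order]
  have hm : Ioo (0:ℝ) 1 ∈ nhds l := isOpen_Ioo.mem_nhds hl
  constructor
  · intro x hx
    have h1 : mCdf ν x < l := by
      by_contra h; exact absurd ((quantile_le_iff ν hl x).2 (not_lt.1 h)) (not_le.2 hx)
    filter_upwards [hm, lt_mem_nhds h1] with l' hl' h'
    by_contra h; exact absurd ((quantile_le_iff ν hl' x).1 (not_lt.1 h)) (not_le.2 h')
  · intro x hx
    obtain ⟨y, hy1, hy2⟩ := exists_between hx
    have h1 := lt_cdf_of_quantile_lt ν hs hl hy1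
    filter_upwards [hm, gt_mem_nhds h1] with l' hl' h'
    exact lt_of_le_of_lt ((quantile_le_iff ν hl' y).2 h'.le) hy2

lemma quantile_map [NullSingletonClass ν] (X : ℝ → ℝ) (hX : Measurable X)
    (hXq : ∀ l ∈ Ioo (0:ℝ) 1, X l = mQuantile ν l) :
    Measure.map X ((volume : Measure ℝ).restrict (Ioo (0:ℝ) 1)) = ν := by
  have : IsFiniteMeasure ((volume : Measure ℝ).restrict (Ioo (0:ℝ) 1)) :=
    ⟨by simp⟩
  refine Measure.ext_of_Iic _ _ (fun a => ?_)
  rw [Measure.map_apply hX measurableSet_Iic,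
    Measure.restrict_apply (hX measurableSet_Iic)]
  have h0 : 0 ≤ mCdf ν a := ENNReal.toReal_nonneg
  have h1 : mCdf ν a ≤ 1 := by rw [mCdf_eq_cdf]; exact ProbabilityTheory.cdf_le_one ν a
  have e : ν (Iic a) = ENNReal.ofReal (mCdf ν a) := (ENNReal.ofReal_toReal (measure_ne_top _ _)).symm
  rw [e]
  have hset : X ⁻¹' Iic a ∩ Ioo 0 1 = Ioc 0 (mCdf ν a) ∩ Ioo 0 1 := by
    ext l
    constructor
    · rintro ⟨h, hl⟩
      have h' : X l ≤ a := h
      rw [hXq l hl] at h'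
      exact ⟨⟨hl.1, (quantile_le_iff ν hl a).1 h'⟩, hl⟩
    · rintro ⟨h, hl⟩
      refine ⟨?_, hl⟩
      change X l ≤ a
      rw [hXq l hl]
      exact (quantile_le_iff ν hl a).2 h.2
  rw [hset]
  apply le_antisymm
  · refine (measure_mono inter_subset_left).trans ?_
    rw [Real.volume_Ioc, sub_zero]
  · have : Ioo 0 (mCdf ν a) ⊆ Ioc 0 (mCdf ν a) ∩ Ioo 0 1 :=
      fun l hl => ⟨Ioo_subset_Ioc_self hl, hl.1, hl.2.trans_le h1⟩
    refine le_trans ?_ (measure_mono this)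
    rw [Real.volume_Ioo, sub_zero]

end quantileFacts

lemma quantile_continuous_time (μ : ℝ → Measure ℝ) [∀ t, IsProbabilityMeasure (μ t)]
    [∀ t, NullSingletonClass (μ t)] (hs : ∀ t, (mSupport (μ t)).OrdConnected)
    (hweak : ∀ f : BoundedContinuousFunction ℝ ℝ, Continuous (fun t => ∫ x, f x ∂(μ t)))
    {l : ℝ} (hl : l ∈ Ioo (0:ℝ) 1) : Continuous (fun t => mQuantile (μ t) l) := by
  have hF : ∀ x, Continuous (fun t => mCdf (μ t) x) := by
    intro x
    rw [continuous_iff_continuousAt]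
    intro t
    let M : ℝ → ProbabilityMeasure ℝ := fun t => ⟨μ t, inferInstance⟩
    have hM : Tendsto M (nhds t) (nhds (M t)) := by
      rw [ProbabilityMeasure.tendsto_iff_forall_integral_tendsto]
      intro f
      exact (hweak f).continuousAt
    have := ProbabilityMeasure.tendsto_measure_of_null_frontier_of_tendsto' hM (E := Iic x)
      (by rw [frontier_Iic]; exact (measure_singleton (μ := μ t) x))
    exact (ENNReal.tendsto_toReal (measure_ne_top _ _)).comp this
  rw [continuous_iff_continuousAt]
  intro t
  rw [ContinuousAt, tendsto_order]
  constructor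
  · intro x hx
    have h1 : mCdf (μ t) x < l := by
      by_contra h; exact absurd ((quantile_le_iff (μ t) hl x).2 (not_lt.1 h)) (not_le.2 hx)
    filter_upwards [(hF x).continuousAt.eventually (gt_mem_nhds h1)] with t' h'
    by_contra h; exact absurd ((quantile_le_iff (μ t') hl x).1 (not_lt.1 h)) (not_le.2 h')
  · intro x hx
    obtain ⟨y, hy1, hy2⟩ := exists_between hx
    have h1 := lt_cdf_of_quantile_lt (μ t) (hs t) hl hy1
    filter_upwards [(hF y).continuousAt.eventually (lt_mem_nhds h1)] with t' h'
    exact lt_of_le_of_lt ((quantile_le_iff (μ t') hl y).2 h'.le) hy2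

section convexFacts

lemma second_deriv_nonneg {h : ℝ → ℝ} (hconv : StrictConvexOn ℝ Set.univ h)
    (hs : ContDiff ℝ 2 h) (k : ℝ) : 0 ≤ deriv (deriv h) k := by
  have hd : Differentiable ℝ h := hs.differentiable (by norm_num)
  have : StrictMono (deriv h) := by
    rw [← strictMonoOn_univ]
    exact hconv.strictMonoOn_deriv (fun x _ => hd x)
  exact this.monotone.deriv_nonneg

lemma deriv_C1 {h : ℝ → ℝ} (hs : ContDiff ℝ 2 h) : ContDiff ℝ 1 (deriv h) := by
  have : ContDiff ℝ (1 + 1) h := by simpa [one_add_one_eq_two] using hs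
  exact (contDiff_succ_iff_deriv.1 this).2.2

lemma second_deriv_cont {h : ℝ → ℝ} (hs : ContDiff ℝ 2 h) : Continuous (deriv (deriv h)) :=
  (deriv_C1 hs).continuous_deriv le_rfl

/-- between any two points the second derivative is positive on a set of positive measure -/
lemma second_deriv_pos_somewhere {h : ℝ → ℝ} (hconv : StrictConvexOn ℝ Set.univ h)
    (hs : ContDiff ℝ 2 h) {a b : ℝ} (hab : a < b) :
    0 < volume (Ioo a b ∩ {k | 0 < deriv (deriv h) k}) := by
  have hd : Differentiable ℝ h := hs.differentiable (by norm_num)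
  have hmono : StrictMono (deriv h) := by
    rw [← strictMonoOn_univ]
    exact hconv.strictMonoOn_deriv (fun x _ => hd x)
  have hopen : IsOpen (Ioo a b ∩ {k | 0 < deriv (deriv h) k}) :=
    isOpen_Ioo.inter (isOpen_lt continuous_const (second_deriv_cont hs))
  refine hopen.measure_pos _ ?_
  obtain ⟨c, hc, hc'⟩ := exists_deriv_eq_slope (deriv h) hab
    (deriv_C1 hs).continuous.continuousOn ((deriv_C1 hs).differentiable one_ne_zero).differentiableOn
  refine ⟨c, hc, ?_⟩
  change 0 < deriv (deriv h) c
  rw [hc']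
  exact div_pos (sub_pos.2 (hmono hab)) (sub_pos.2 hab)

/-- remainder kernel -/
noncomputable def Rk (k z : ℝ) : ℝ := if 0 ≤ k then max (z - k) 0 else max (k - z) 0

/-- Bregman remainder at zero -/
noncomputable def bphi (h : ℝ → ℝ) (z : ℝ) : ℝ := h z - h 0 - deriv h 0 * z

lemma Rk_nonneg (k z : ℝ) : 0 ≤ Rk k z := by
  unfold Rk; split_ifs <;> exact le_max_right _ _

lemma Rk_measurable : Measurable (Function.uncurry Rk) := by
  unfold Rk Function.uncurry
  refine Measurable.ite (measurableSet_le measurable_const measurable_fst) ?_ ?_ <;> fun_prop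

lemma taylor_int {h : ℝ → ℝ} (hs : ContDiff ℝ 2 h) (z : ℝ) :
    ∫ k in (0:ℝ)..z, deriv (deriv h) k * (z - k) = bphi h z := by
  have hd : Differentiable ℝ h := hs.differentiable (by norm_num)
  have hd1 : Differentiable ℝ (deriv h) := (deriv_C1 hs).differentiable one_ne_zero
  have hder : ∀ k ∈ uIcc 0 z, HasDerivAt (fun k => deriv h k * (z - k) + h k)
      (deriv (deriv h) k * (z - k)) k := by
    intro k _
    have h1 := (hd1 k).hasDerivAt.mul ((hasDerivAt_id k).const_sub z)
    have h2 := h1.add (hd k).hasDerivAt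
    refine HasDerivAt.congr_deriv h2 ?_
    simp
  rw [intervalIntegral.integral_eq_sub_of_hasDerivAt hder]
  · simp [bphi]; ring
  · exact ((second_deriv_cont hs).mul (by fun_prop)).intervalIntegrable _ _

lemma bphi_lintegral {h : ℝ → ℝ} (hconv : StrictConvexOn ℝ Set.univ h)
    (hs : ContDiff ℝ 2 h) (z : ℝ) :
    ENNReal.ofReal (bphi h z) =
      ∫⁻ k, ENNReal.ofReal (deriv (deriv h) k) * ENNReal.ofReal (Rk k z) := by
  have hn := second_deriv_nonneg hconv hs
  have hcont : Continuous (fun k => deriv (deriv h) k * (z - k)) :=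
    (second_deriv_cont hs).mul (by fun_prop)
  simp_rw [← ENNReal.ofReal_mul (hn _)]
  rw [← taylor_int hs z]
  rcases le_total 0 z with hz | hz
  · rw [intervalIntegral.integral_of_le hz, ofReal_integral_eq_lintegral_ofReal
      (hcont.integrableOn_Ioc)]
    · rw [← lintegral_indicator measurableSet_Ioc]
      refine lintegral_congr_ae ?_
      have : ∀ᵐ k : ℝ, k ≠ 0 := by simp [ae_iff]
      filter_upwards [this] with k hk
      by_cases hm : k ∈ Ioc 0 z
      · rw [indicator_of_mem hm, Rk, if_pos hm.1.le, max_eq_left (by linarith [hm.2])]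
      · rw [indicator_of_notMem hm]
        have : Rk k z = 0 := by
          unfold Rk
          split_ifs with h0
          · have : z < k := by
              by_contra hh
              exact hm ⟨lt_of_le_of_ne h0 (Ne.symm hk), not_lt.1 hh⟩
            exact max_eq_right (by linarith)
          · exact max_eq_right (by linarith)
        simp [this]
    · refine (ae_restrict_iff' measurableSet_Ioc).2 (Eventually.of_forall fun k hk => ?_)
      exact mul_nonneg (hn k) (by linarith [hk.2])
  · rw [intervalIntegral.integral_of_ge hz, ← integral_neg, ofReal_integral_eq_lintegral_ofReal
      (f := fun k => -(deriv (deriv h) k * (z - k))) hcont.neg.integrableOn_Ioc]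
    · rw [← lintegral_indicator measurableSet_Ioc]
      refine lintegral_congr_ae ?_
      have : ∀ᵐ k : ℝ, k ≠ 0 := by simp [ae_iff]
      filter_upwards [this] with k hk
      by_cases hm : k ∈ Ioc z 0
      · have : k < 0 := lt_of_le_of_ne hm.2 hk
        rw [indicator_of_mem hm, Rk, if_neg (by linarith), max_eq_left (by linarith [hm.1])]
        congr 1; ring
      · rw [indicator_of_notMem hm]
        have : Rk k z = 0 := by
          unfold Rk
          split_ifs with h0
          · exact max_eq_right (by linarith)
          · have : k ≤ z := by
              by_contra hh
              exact hm ⟨not_le.1 hh, (not_le.1 h0).le⟩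
            exact max_eq_right (by linarith)
        simp [this]
    · refine (ae_restrict_iff' measurableSet_Ioc).2 (Eventually.of_forall fun k hk => ?_)
      have := mul_nonneg (hn k) (by linarith [hk.1] : 0 ≤ k - z)
      change 0 ≤ -(deriv (deriv h) k * (z - k))
      linarith

lemma bphi_strictConvex {h : ℝ → ℝ} (hconv : StrictConvexOn ℝ Set.univ h) :
    StrictConvexOn ℝ Set.univ (bphi h) := by
  refine ⟨convex_univ, fun x hx y hy hxy a b ha hb hab => ?_⟩
  have := hconv.2 hx hy hxy ha hb hab
  simp only [smul_eq_mul, bphi] at this ⊢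
  have e : h 0 = a * h 0 + b * h 0 := by rw [← add_mul, hab, one_mul]
  linarith

lemma bphi_pos {h : ℝ → ℝ} (hconv : StrictConvexOn ℝ Set.univ h)
    (hs : ContDiff ℝ 2 h) {z : ℝ} (hz : z ≠ 0) : 0 < bphi h z := by
  have hd : Differentiable ℝ h := hs.differentiable (by norm_num)
  unfold bphi
  rcases lt_or_gt_of_ne hz with h1 | h1
  · have := hconv.slope_lt_deriv (mem_univ z) (mem_univ 0) h1 (hd 0)
    rw [slope_def_field, div_lt_iff₀ (by linarith)] at this
    linarith
  · have := hconv.deriv_lt_slope (mem_univ 0) (mem_univ z) h1 (hd 0)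
    rw [slope_def_field, lt_div_iff₀ (by linarith)] at this
    linarith

lemma bphi_nonneg {h : ℝ → ℝ} (hconv : StrictConvexOn ℝ Set.univ h)
    (hs : ContDiff ℝ 2 h) (z : ℝ) : 0 ≤ bphi h z := by
  rcases eq_or_ne z 0 with rfl | hz
  · simp [bphi]
  · exact (bphi_pos hconv hs hz).le

lemma abs_le_bphi {h : ℝ → ℝ} (hconv : StrictConvexOn ℝ Set.univ h)
    (hs : ContDiff ℝ 2 h) : ∃ C : ℝ, 0 ≤ C ∧ ∀ z, |z| ≤ C * bphi h z + 1 := by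
  have p1 := bphi_pos hconv hs (z := 1) one_ne_zero
  have p2 := bphi_pos hconv hs (z := -1) (by norm_num)
  have hc := (bphi_strictConvex hconv).convexOn
  have h0 : bphi h 0 = 0 := by simp [bphi]
  refine ⟨(bphi h 1)⁻¹ + (bphi h (-1))⁻¹, by positivity, fun z => ?_⟩
  have hn := bphi_nonneg hconv hs z
  rcases le_or_gt |z| 1 with h1 | h1
  · have : 0 ≤ ((bphi h 1)⁻¹ + (bphi h (-1))⁻¹) * bphi h z := by positivity
    linarith
  · have key : ∀ e : ℝ, |e| = 1 → z = |z| * e → 0 < bphi h e → |z| ≤ (bphi h e)⁻¹ * bphi h z := by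
      intro e he hz hp
      have hzp : 0 < |z| := by linarith
      have := hc.2 (mem_univ z) (mem_univ 0) (inv_nonneg.2 hzp.le)
        (sub_nonneg.2 (inv_le_one_of_one_le₀ h1.le)) (by ring)
      simp only [smul_eq_mul, h0, mul_zero, add_zero] at this
      have e2 : |z|⁻¹ * z = e := by
        nth_rewrite 2 [hz]; field_simp
      rw [e2] at this
      rw [le_inv_mul_iff₀ hp]
      rw [le_inv_mul_iff₀ hzp] at this
      linarith
    have q1 : 0 ≤ (bphi h 1)⁻¹ * bphi h z := by positivity
    have q2 : 0 ≤ (bphi h (-1))⁻¹ * bphi h z := by positivity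
    rw [add_mul]
    rcases le_total 0 z with hz | hz
    · have := key 1 (by simp) (by rw [abs_of_nonneg hz]; ring) p1
      linarith
    · have := key (-1) (by simp) (by rw [abs_of_nonpos hz]; ring) p2
      linarith

end convexFacts

section processes

set_option linter.unusedSectionVars false

/-- Lebesgue measure on the unit time interval -/
noncomputable abbrev tauM : Measure ℝ := (volume : Measure ℝ).restrict (Icc (0:ℝ) 1)

/-- Lebesgue measure on the open unit interval -/
noncomputable abbrev lamM : Measure ℝ := (volume : Measure ℝ).restrict (Ioo (0:ℝ) 1)

instance tauM_prob : IsProbabilityMeasure tauM := ⟨by simp⟩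

instance lamM_prob : IsProbabilityMeasure lamM := ⟨by simp⟩

structure IsProc {Ω : Type*} [MeasurableSpace Ω] (μ : ℝ → Measure ℝ) (P : Measure Ω)
    (W : ℝ → Ω → ℝ) : Prop where
  cont : ∀ ω, Continuous (fun t => W t ω)
  meas : ∀ t, Measurable (W t)
  law : ∀ t, Measure.map (W t) P = μ t

structure Moments (μ : ℝ → Measure ℝ) (h : ℝ → ℝ) : Prop where
  m1 : ∀ t, Integrable (fun x : ℝ => x) (μ t)
  m1' : Integrable (fun t => ∫ x, x ∂(μ t)) tauM
  mh : ∀ t, Integrable h (μ t)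
  mh' : Integrable (fun t => ∫ x, h x ∂(μ t)) tauM

variable {Ω : Type*} [MeasurableSpace Ω] {μ : ℝ → Measure ℝ} {P : Measure Ω}
  [IsProbabilityMeasure P] {W : ℝ → Ω → ℝ} {h : ℝ → ℝ}

lemma cont_integrable_tau {f : ℝ → ℝ} (hf : Continuous f) : Integrable f tauM :=
  hf.integrableOn_Icc

lemma IsProc.joint (hW : IsProc μ P W) : Measurable (Function.uncurry W) :=
  measurable_uncurry_of_continuous_of_measurable hW.cont hW.meas

lemma IsProc.integral_law (hW : IsProc μ P W) (t : ℝ) {f : ℝ → ℝ} (hf : Continuous f) :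
    ∫ ω, f (W t ω) ∂P = ∫ x, f x ∂(μ t) := by
  rw [← hW.law t, integral_map (hW.meas t).aemeasurable hf.aestronglyMeasurable]

lemma IsProc.integrable_law (hW : IsProc μ P W) (t : ℝ) {f : ℝ → ℝ} (hf : Continuous f)
    (hi : Integrable f (μ t)) : Integrable (fun ω => f (W t ω)) P := by
  rw [← hW.law t, integrable_map_measure hf.aestronglyMeasurable (hW.meas t).aemeasurable] at hi
  exact hi

lemma bphi_cont (hs : ContDiff ℝ 2 h) : Continuous (bphi h) := by
  have := hs.continuous
  unfold bphi; fun_prop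

lemma Moments.phi [∀ t, IsProbabilityMeasure (μ t)] (hM : Moments μ h) (t : ℝ) :
    Integrable (bphi h) (μ t) :=
  ((hM.mh t).sub (integrable_const _)).sub ((hM.m1 t).const_mul _)

lemma Moments.phi' [∀ t, IsProbabilityMeasure (μ t)] (hM : Moments μ h) :
    Integrable (fun t => ∫ x, bphi h x ∂(μ t)) tauM := by
  have : (fun t => ∫ x, bphi h x ∂(μ t)) =
      fun t => (∫ x, h x ∂(μ t)) - h 0 - deriv h 0 * ∫ x, x ∂(μ t) := by
    funext t
    unfold bphi
    have i1 : Integrable (fun x => h x - h 0) (μ t) := (hM.mh t).sub (integrable_const _)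
    rw [integral_sub i1 ((hM.m1 t).const_mul _), integral_sub (hM.mh t) (integrable_const _), integral_const_mul]
    simp
  rw [this]
  exact (hM.mh'.sub (integrable_const _)).sub (hM.m1'.const_mul _)

lemma IsProc.phi_prod [∀ t, IsProbabilityMeasure (μ t)] (hconv : StrictConvexOn ℝ Set.univ h)
    (hs : ContDiff ℝ 2 h) (hM : Moments μ h) (hW : IsProc μ P W) :
    Integrable (fun p : ℝ × Ω => bphi h (W p.1 p.2)) (tauM.prod P) := by
  have hc := bphi_cont hs
  have hm : Measurable (fun p : ℝ × Ω => bphi h (W p.1 p.2)) :=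
    hc.measurable.comp hW.joint
  rw [integrable_prod_iff hm.aestronglyMeasurable]
  refine ⟨Eventually.of_forall fun t => hW.integrable_law t hc (hM.phi t), ?_⟩
  refine hM.phi'.congr (Eventually.of_forall fun t => ?_)
  simp only [Real.norm_eq_abs, abs_of_nonneg (bphi_nonneg hconv hs _)]
  exact (hW.integral_law t hc).symm

lemma IsProc.prod [∀ t, IsProbabilityMeasure (μ t)] (hconv : StrictConvexOn ℝ Set.univ h)
    (hs : ContDiff ℝ 2 h) (hM : Moments μ h) (hW : IsProc μ P W) :
    Integrable (fun p : ℝ × Ω => W p.1 p.2) (tauM.prod P) := by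
  obtain ⟨C, hC, hb⟩ := abs_le_bphi hconv hs
  have := ((hW.phi_prod hconv hs hM).const_mul C).add (integrable_const (1:ℝ))
  refine this.mono' hW.joint.aestronglyMeasurable (Eventually.of_forall fun p => ?_)
  exact hb _

lemma IsProc.Z_int [∀ t, IsProbabilityMeasure (μ t)] (hconv : StrictConvexOn ℝ Set.univ h)
    (hs : ContDiff ℝ 2 h) (hM : Moments μ h) (hW : IsProc μ P W) :
    Integrable (fun ω => ∫ t, W t ω ∂tauM) P :=
  (hW.prod hconv hs hM).integral_prod_right

lemma IsProc.Z_meas (hW : IsProc μ P W) : Measurable (fun ω => ∫ t, W t ω ∂tauM) :=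
  (hW.joint.stronglyMeasurable.integral_prod_left').measurable

lemma IsProc.Z_exp [∀ t, IsProbabilityMeasure (μ t)] (hconv : StrictConvexOn ℝ Set.univ h)
    (hs : ContDiff ℝ 2 h) (hM : Moments μ h) (hW : IsProc μ P W) :
    ∫ ω, (∫ t, W t ω ∂tauM) ∂P = ∫ t, (∫ x, x ∂(μ t)) ∂tauM := by
  rw [← integral_integral_swap (f := W) (hW.prod hconv hs hM)]
  refine integral_congr_ae (Eventually.of_forall fun t => ?_)
  exact hW.integral_law t continuous_id

lemma IsProc.phiZ_int [∀ t, IsProbabilityMeasure (μ t)] (hconv : StrictConvexOn ℝ Set.univ h)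
    (hs : ContDiff ℝ 2 h) (hM : Moments μ h) (hW : IsProc μ P W) :
    Integrable (fun ω => bphi h (∫ t, W t ω ∂tauM)) P := by
  have hc := bphi_cont hs
  refine (hW.phi_prod hconv hs hM).integral_prod_right.mono'
    (hc.measurable.comp hW.Z_meas).aestronglyMeasurable (Eventually.of_forall fun ω => ?_)
  rw [Real.norm_eq_abs, abs_of_nonneg (bphi_nonneg hconv hs _)]
  exact (bphi_strictConvex hconv).convexOn.map_integral_le hc.continuousOn isClosed_univ
    (by simp) (cont_integrable_tau (hW.cont ω)) (cont_integrable_tau (hc.comp (hW.cont ω)))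

lemma IsProc.J_prod [∀ t, IsProbabilityMeasure (μ t)] (hconv : StrictConvexOn ℝ Set.univ h)
    (hs : ContDiff ℝ 2 h) (hM : Moments μ h) (hW : IsProc μ P W) {c : ℝ → ℝ}
    (hc : Continuous c) :
    Integrable (fun p : ℝ × Ω => max (W p.1 p.2 - c p.1) 0) (tauM.prod P) := by
  have h1 : Integrable (fun p : ℝ × Ω => c p.1) (tauM.prod P) :=
    (cont_integrable_tau hc).comp_fst P
  exact ((hW.prod hconv hs hM).sub h1).pos_part

lemma IsProc.J_exp [∀ t, IsProbabilityMeasure (μ t)] (hconv : StrictConvexOn ℝ Set.univ h)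
    (hs : ContDiff ℝ 2 h) (hM : Moments μ h) (hW : IsProc μ P W) {c : ℝ → ℝ}
    (hc : Continuous c) :
    ∫ ω, (∫ t, max (W t ω - c t) 0 ∂tauM) ∂P =
      ∫ t, (∫ x, max (x - c t) 0 ∂(μ t)) ∂tauM := by
  rw [← integral_integral_swap (f := fun t ω => max (W t ω - c t) 0)
    (hW.J_prod hconv hs hM hc)]
  refine integral_congr_ae (Eventually.of_forall fun t => ?_)
  exact hW.integral_law (f := fun x => max (x - c t) 0) t (by fun_prop)

/-- pathwise stop-loss bound -/
lemma path_bound {y c : ℝ → ℝ} (hy : Continuous y) (hc : Continuous c) :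
    max ((∫ t, y t ∂tauM) - ∫ t, c t ∂tauM) 0 ≤ ∫ t, max (y t - c t) 0 ∂tauM := by
  rw [← integral_sub (cont_integrable_tau hy) (cont_integrable_tau hc)]
  refine max_le ?_ (integral_nonneg fun t => le_max_right _ _)
  refine integral_mono (cont_integrable_tau (hy.sub hc)) (cont_integrable_tau (by fun_prop))
    fun t => le_max_left _ _

lemma cont_nonneg_zero {f : ℝ → ℝ} (hf : Continuous f) (h0 : ∀ t, 0 ≤ f t)
    (hi : ∫ t, f t ∂tauM = 0) : ∀ t ∈ Icc (0:ℝ) 1, f t = 0 := by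
  rw [integral_eq_zero_iff_of_nonneg_ae (Eventually.of_forall h0) (cont_integrable_tau hf)] at hi
  exact Measure.eqOn_Icc_of_ae_eq volume zero_ne_one hi hf.continuousOn continuousOn_const

lemma path_eq {y c : ℝ → ℝ} (hy : Continuous y) (hc : Continuous c)
    (he : max ((∫ t, y t ∂tauM) - ∫ t, c t ∂tauM) 0 = ∫ t, max (y t - c t) 0 ∂tauM) :
    (∀ t ∈ Icc (0:ℝ) 1, y t ≤ c t) ∨ (∀ t ∈ Icc (0:ℝ) 1, c t ≤ y t) := by
  have hm : Continuous (fun t => max (y t - c t) 0) := by fun_prop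
  rw [← integral_sub (cont_integrable_tau hy) (cont_integrable_tau hc)] at he
  rcases le_total (∫ t, (y t - c t) ∂tauM) 0 with h1 | h1
  · left
    rw [max_eq_right h1] at he
    intro t ht
    have := cont_nonneg_zero hm (fun t => le_max_right _ _) he.symm t ht
    have := this ▸ le_max_left (y t - c t) 0
    linarith
  · right
    rw [max_eq_left h1] at he
    intro t ht
    have h2 : ∫ t, (max (y t - c t) 0 - (y t - c t)) ∂tauM = 0 := by
      have i1 : Integrable (fun t => y t - c t) tauM := cont_integrable_tau (hy.sub hc)
      rw [integral_sub (cont_integrable_tau hm) i1, he, sub_self]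
    have := cont_nonneg_zero (f := fun t => max (y t - c t) 0 - (y t - c t)) (by fun_prop)
      (fun t => sub_nonneg.2 (le_max_left _ _)) h2 t ht
    have := le_max_right (y t - c t) 0
    linarith

end processes

section stopLoss

variable {Ω : Type*} [MeasurableSpace Ω] {μ : ℝ → Measure ℝ} {P : Measure Ω}
  [IsProbabilityMeasure P] {Y : ℝ → Ω → ℝ} {X : ℝ → ℝ → ℝ} {h : ℝ → ℝ}

lemma G_strictMono (hX : IsProc μ lamM X) (hXm : ∀ t, StrictMonoOn (X t) (Ioo (0:ℝ) 1)) :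
    StrictMonoOn (fun l => ∫ t, X t l ∂tauM) (Ioo (0:ℝ) 1) := by
  intro a ha b hb hab
  have hpos : ∀ t, 0 < X t b - X t a := fun t => sub_pos.2 (hXm t ha hb hab)
  have hc : Continuous (fun t => X t b - X t a) := (hX.cont b).sub (hX.cont a)
  have h0 : 0 ≤ ∫ t, (X t b - X t a) ∂tauM := integral_nonneg fun t => (hpos t).le
  have h1 : ∫ t, (X t b - X t a) ∂tauM ≠ 0 := by
    intro he
    have := cont_nonneg_zero hc (fun t => (hpos t).le) he 0 (by simp)
    exact (hpos 0).ne' this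
  have h2 := lt_of_le_of_ne h0 h1.symm
  rw [integral_sub (cont_integrable_tau (hX.cont b)) (cont_integrable_tau (hX.cont a))] at h2
  exact sub_pos.1 h2

lemma G_cont (hX : IsProc μ lamM X) (hXm : ∀ t, StrictMonoOn (X t) (Ioo (0:ℝ) 1))
    (hXc : ∀ t, ContinuousOn (X t) (Ioo (0:ℝ) 1)) :
    ContinuousOn (fun l => ∫ t, X t l ∂tauM) (Ioo (0:ℝ) 1) := by
  intro l hl
  apply ContinuousAt.continuousWithinAt
  obtain ⟨a, ha0, hal⟩ := exists_between hl.1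
  obtain ⟨b, hbl, hb1⟩ := exists_between hl.2
  have ha : a ∈ Ioo (0:ℝ) 1 := ⟨ha0, hal.trans hl.2⟩
  have hb : b ∈ Ioo (0:ℝ) 1 := ⟨hl.1.trans hbl, hb1⟩
  refine continuousAt_of_dominated (bound := fun t => |X t a| + |X t b|) ?_ ?_ ?_ ?_
  · exact Eventually.of_forall fun l' => (hX.cont l').aestronglyMeasurable
  · filter_upwards [Ioo_mem_nhds hal hbl] with l' hl'
    refine Eventually.of_forall fun t => ?_
    have hl'' : l' ∈ Ioo (0:ℝ) 1 := ⟨ha0.trans hl'.1, hl'.2.trans hb1⟩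
    have h1 := hXm t ha hl'' hl'.1
    have h2 := hXm t hl'' hb hl'.2
    rw [Real.norm_eq_abs, abs_le]
    constructor
    · linarith [neg_abs_le (X t a), abs_nonneg (X t b)]
    · linarith [le_abs_self (X t b), abs_nonneg (X t a)]
  · exact cont_integrable_tau ((hX.cont a).abs.add (hX.cont b).abs)
  · exact Eventually.of_forall fun t => (hXc t).continuousAt (isOpen_Ioo.mem_nhds hl)

lemma G_comonotone (hX : IsProc μ lamM X) (hXm : ∀ t, StrictMonoOn (X t) (Ioo (0:ℝ) 1))
    {l s : ℝ} (hl : l ∈ Ioo (0:ℝ) 1) (hs : s ∈ Ioo (0:ℝ) 1) :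
    ∫ t, max (X t s - X t l) 0 ∂tauM =
      max ((∫ t, X t s ∂tauM) - ∫ t, X t l ∂tauM) 0 := by
  rcases le_total s l with hsl | hsl
  · have h1 : ∀ t, max (X t s - X t l) 0 = 0 := fun t =>
      max_eq_right (sub_nonpos.2 ((hXm t).monotoneOn hs hl hsl))
    have h2 := (G_strictMono hX hXm).monotoneOn hs hl hsl
    rw [max_eq_right (sub_nonpos.2 h2)]
    simp [h1]
  · have h1 : ∀ t, max (X t s - X t l) 0 = X t s - X t l := fun t =>
      max_eq_left (sub_nonneg.2 ((hXm t).monotoneOn hl hs hsl))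
    have h2 := (G_strictMono hX hXm).monotoneOn hl hs hsl
    rw [max_eq_left (sub_nonneg.2 h2)]
    simp_rw [h1]
    exact integral_sub (cont_integrable_tau (hX.cont s)) (cont_integrable_tau (hX.cont l))

variable [∀ t, IsProbabilityMeasure (μ t)]

lemma J_eq (hconv : StrictConvexOn ℝ Set.univ h) (hs : ContDiff ℝ 2 h) (hM : Moments μ h)
    (hX : IsProc μ lamM X) (hXm : ∀ t, StrictMonoOn (X t) (Ioo (0:ℝ) 1))
    (hY : IsProc μ P Y) {l : ℝ} (hl : l ∈ Ioo (0:ℝ) 1) :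
    ∫ ω, (∫ t, max (Y t ω - X t l) 0 ∂tauM) ∂P =
      ∫ s, max ((∫ t, X t s ∂tauM) - ∫ t, X t l ∂tauM) 0 ∂lamM := by
  rw [hY.J_exp hconv hs hM (hX.cont l), ← hX.J_exp hconv hs hM (hX.cont l)]
  refine setIntegral_congr_fun measurableSet_Ioo fun s hs => ?_
  exact G_comonotone hX hXm hl hs

lemma SL_quantile (hconv : StrictConvexOn ℝ Set.univ h) (hs : ContDiff ℝ 2 h) (hM : Moments μ h)
    (hX : IsProc μ lamM X) (hXm : ∀ t, StrictMonoOn (X t) (Ioo (0:ℝ) 1))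
    (hY : IsProc μ P Y) {l : ℝ} (hl : l ∈ Ioo (0:ℝ) 1) :
    ∫ ω, max ((∫ t, Y t ω ∂tauM) - ∫ t, X t l ∂tauM) 0 ∂P ≤
      ∫ s, max ((∫ t, X t s ∂tauM) - ∫ t, X t l ∂tauM) 0 ∂lamM := by
  rw [← J_eq hconv hs hM hX hXm hY hl]
  exact integral_mono (((hY.Z_int hconv hs hM).sub (integrable_const _)).pos_part)
    (hY.J_prod hconv hs hM (hX.cont l)).integral_prod_right
    fun ω => path_bound (hY.cont ω) (hX.cont l)

lemma SL_all (hconv : StrictConvexOn ℝ Set.univ h) (hs : ContDiff ℝ 2 h) (hM : Moments μ h)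
    (hX : IsProc μ lamM X) (hXm : ∀ t, StrictMonoOn (X t) (Ioo (0:ℝ) 1))
    (hY : IsProc μ P Y) (k : ℝ) :
    ∫ ω, max ((∫ t, Y t ω ∂tauM) - k) 0 ∂P ≤ ∫ s, max ((∫ t, X t s ∂tauM) - k) 0 ∂lamM := by
  have hZi := hY.Z_int hconv hs hM
  have hGi := hX.Z_int hconv hs hM
  have hZm := hY.Z_meas
  have hEq : ∫ ω, (∫ t, Y t ω ∂tauM) ∂P = ∫ s, (∫ t, X t s ∂tauM) ∂lamM :=
    (hY.Z_exp hconv hs hM).trans (hX.Z_exp hconv hs hM).symm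
  have hQ := fun {l} (hl : l ∈ Ioo (0:ℝ) 1) => SL_quantile hconv hs hM hX hXm hY hl
  have hGm := G_strictMono hX hXm
  set Z := fun ω => ∫ t, Y t ω ∂tauM with hZ
  set G := fun s => ∫ t, X t s ∂tauM with hG
  change ∫ ω, max (Z ω - k) 0 ∂P ≤ ∫ s, max (G s - k) 0 ∂lamM
  change ∀ {l}, l ∈ Ioo (0:ℝ) 1 → ∫ ω, max (Z ω - G l) 0 ∂P ≤ ∫ s, max (G s - G l) 0 ∂lamM at hQ
  change ∫ ω, Z ω ∂P = ∫ s, G s ∂lamM at hEq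
  have hZp : ∀ c, Integrable (fun ω => max (Z ω - c) 0) P := fun c =>
    (hZi.sub (integrable_const c)).pos_part
  have hGp : ∀ c, Integrable (fun s => max (G s - c) 0) lamM := fun c =>
    (hGi.sub (integrable_const c)).pos_part
  have hA : MeasurableSet {ω | k < Z ω} := measurableSet_lt measurable_const hZm
  set p := P.real {ω | k < Z ω} with hp
  have hp0 : 0 ≤ p := measureReal_nonneg
  have hp1 : p ≤ 1 := measureReal_le_one
  rcases hp0.eq_or_lt with h0 | h0
  · have hnull : P {ω | k < Z ω} = 0 := (measureReal_eq_zero_iff).1 h0.symm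
    have : ∫ ω, max (Z ω - k) 0 ∂P = 0 := by
      refine integral_eq_zero_of_ae ?_
      have : ∀ᵐ ω ∂P, ¬ k < Z ω := by rw [ae_iff]; simpa using hnull
      filter_upwards [this] with ω hω
      exact max_eq_right (sub_nonpos.2 (not_lt.1 hω))
    rw [this]
    exact integral_nonneg fun s => le_max_right _ _
  rcases hp1.eq_or_lt with h1 | h1
  · have hfull : ∀ᵐ ω ∂P, k < Z ω := by
      have : P {ω | k < Z ω} = 1 := by
        rw [← ENNReal.toReal_eq_one_iff]; exact h1
      exact (prob_compl_eq_zero_iff hA).2 this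
    calc ∫ ω, max (Z ω - k) 0 ∂P = ∫ ω, (Z ω - k) ∂P := by
          refine integral_congr_ae ?_
          filter_upwards [hfull] with ω hω
          exact max_eq_left (by linarith)
      _ = ∫ s, (G s - k) ∂lamM := by
          rw [integral_sub hZi (integrable_const _), integral_sub hGi (integrable_const _), hEq]
          simp
      _ ≤ _ := integral_mono (hGi.sub (integrable_const _)) (hGp k) fun s => le_max_left _ _
  · have hl : 1 - p ∈ Ioo (0:ℝ) 1 := ⟨by linarith, by linarith⟩
    set l := 1 - p with hldef
    have i1 : Integrable ({ω | k < Z ω}.indicator (fun _ => G l - k)) P :=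
      (integrable_const _).indicator hA
    have i2 : Integrable ((Ioi l).indicator (fun _ => G l - k)) lamM :=
      (integrable_const _).indicator measurableSet_Ioi
    calc ∫ ω, max (Z ω - k) 0 ∂P
        ≤ ∫ ω, (max (Z ω - G l) 0 + {ω | k < Z ω}.indicator (fun _ => G l - k) ω) ∂P := by
          refine integral_mono (hZp k) ((hZp _).add i1) fun ω => ?_
          by_cases hω : k < Z ω
          · simp only [indicator_of_mem (show ω ∈ {ω | k < Z ω} from hω)]
            rw [max_eq_left (by linarith)]
            linarith [le_max_left (Z ω - G l) 0]
          · simp only [indicator_of_notMem (show ω ∉ {ω | k < Z ω} from hω)]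
            rw [max_eq_right (by linarith)]
            linarith [le_max_right (Z ω - G l) 0]
      _ = ∫ ω, max (Z ω - G l) 0 ∂P + p * (G l - k) := by
          rw [integral_add (hZp _) i1, integral_indicator_const _ hA, smul_eq_mul]
      _ ≤ ∫ s, max (G s - G l) 0 ∂lamM + p * (G l - k) := by linarith [hQ hl]
      _ = ∫ s, (max (G s - G l) 0 + (Ioi l).indicator (fun _ => G l - k) s) ∂lamM := by
          rw [integral_add (hGp _) i2, integral_indicator_const _ measurableSet_Ioi, smul_eq_mul]
          have : lamM.real (Ioi l) = p := by
            rw [measureReal_def, Measure.restrict_apply measurableSet_Ioi]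
            have : Ioi l ∩ Ioo 0 1 = Ioo l 1 := by
              ext s; constructor
              · rintro ⟨a, b, c⟩; exact ⟨a, c⟩
              · rintro ⟨a, c⟩; exact ⟨a, hl.1.trans a, c⟩
            rw [this, Real.volume_Ioo, ENNReal.toReal_ofReal (by linarith [hl.2])]
            rw [hldef]; ring
          rw [this]
      _ ≤ ∫ s, max (G s - k) 0 ∂lamM := by
          refine setIntegral_mono_on ((hGp _).add i2) (hGp k) measurableSet_Ioo fun s hs => ?_
          by_cases hsl : l < s
          · rw [indicator_of_mem (show s ∈ Ioi l from hsl)]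
            rw [max_eq_left (a := G s - G l) (by linarith [hGm hl hs hsl])]
            linarith [le_max_left (G s - k) 0]
          · rw [indicator_of_notMem (show s ∉ Ioi l from hsl)]
            rw [max_eq_right (a := G s - G l)
              (by linarith [hGm.monotoneOn hs hl (not_lt.1 hsl)])]
            linarith [le_max_right (G s - k) 0]

lemma Rk_exp {Z : Ω → ℝ} (hZ : Integrable Z P) (k : ℝ) :
    Integrable (fun ω => Rk k (Z ω)) P ∧ ∫ ω, Rk k (Z ω) ∂P =
      if 0 ≤ k then ∫ ω, max (Z ω - k) 0 ∂P
      else ∫ ω, max (Z ω - k) 0 ∂P - (∫ ω, Z ω ∂P - k) := by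
  have i0 : Integrable (fun ω => Z ω - k) P := hZ.sub (integrable_const k)
  have i1 : Integrable (fun ω => max (Z ω - k) 0) P := i0.pos_part
  unfold Rk
  split_ifs with hk
  · exact ⟨i1, rfl⟩
  · have e : ∀ ω, max (k - Z ω) 0 = max (Z ω - k) 0 - (Z ω - k) := by
      intro ω
      rcases le_total k (Z ω) with h1 | h1
      · rw [max_eq_right (by linarith), max_eq_left (by linarith)]; ring
      · rw [max_eq_left (by linarith), max_eq_right (by linarith)]; ring
    simp_rw [e]
    refine ⟨i1.sub i0, ?_⟩
    rw [integral_sub i1 i0, integral_sub hZ (integrable_const k)]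
    simp

lemma bphi_tonelli (hconv : StrictConvexOn ℝ Set.univ h) (hs : ContDiff ℝ 2 h)
    {Z : Ω → ℝ} (hZm : Measurable Z) (hZ : Integrable Z P)
    (hphi : Integrable (fun ω => bphi h (Z ω)) P) :
    ENNReal.ofReal (∫ ω, bphi h (Z ω) ∂P) =
      ∫⁻ k, ENNReal.ofReal (deriv (deriv h) k) * ENNReal.ofReal (∫ ω, Rk k (Z ω) ∂P) := by
  rw [ofReal_integral_eq_lintegral_ofReal hphi
    (Eventually.of_forall fun ω => bphi_nonneg hconv hs _)]
  simp_rw [bphi_lintegral hconv hs]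
  have hm2 : Measurable (fun k => ENNReal.ofReal (deriv (deriv h) k)) :=
    (second_deriv_cont hs).measurable.ennreal_ofReal
  have hmR : Measurable (fun p : Ω × ℝ => ENNReal.ofReal (Rk p.2 (Z p.1))) :=
    (Rk_measurable.comp (measurable_snd.prodMk (hZm.comp measurable_fst))).ennreal_ofReal
  rw [lintegral_lintegral_swap ((hm2.comp measurable_snd).mul hmR).aemeasurable]
  refine lintegral_congr fun k => ?_
  have hmk : Measurable (fun ω => ENNReal.ofReal (Rk k (Z ω))) :=
    hmR.comp (measurable_id.prodMk measurable_const)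
  rw [lintegral_const_mul _ hmk,
    ofReal_integral_eq_lintegral_ofReal (Rk_exp hZ k).1
      (Eventually.of_forall fun ω => Rk_nonneg _ _)]

lemma SL_eq_ae (hconv : StrictConvexOn ℝ Set.univ h) (hs : ContDiff ℝ 2 h) (hM : Moments μ h)
    (hX : IsProc μ lamM X) (hXm : ∀ t, StrictMonoOn (X t) (Ioo (0:ℝ) 1))
    (hY : IsProc μ P Y)
    (heq : ∫ ω, h (∫ t, Y t ω ∂tauM) ∂P = ∫ s, h (∫ t, X t s ∂tauM) ∂lamM) :
    ∀ᵐ k : ℝ, 0 < deriv (deriv h) k →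
      ∫ ω, max ((∫ t, Y t ω ∂tauM) - k) 0 ∂P = ∫ s, max ((∫ t, X t s ∂tauM) - k) 0 ∂lamM := by
  have hZi := hY.Z_int hconv hs hM
  have hGi := hX.Z_int hconv hs hM
  have hZp := hY.phiZ_int hconv hs hM
  have hGp := hX.phiZ_int hconv hs hM
  have hZm := hY.Z_meas
  have hGm := hX.Z_meas
  have hEq : ∫ ω, (∫ t, Y t ω ∂tauM) ∂P = ∫ s, (∫ t, X t s ∂tauM) ∂lamM :=
    (hY.Z_exp hconv hs hM).trans (hX.Z_exp hconv hs hM).symm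
  have hSL := SL_all hconv hs hM hX hXm hY
  generalize hZ : (fun ω => ∫ t, Y t ω ∂tauM) = Z at *
  generalize hG : (fun s => ∫ t, X t s ∂tauM) = G at *
  have eZ : ∀ ω, ∫ t, Y t ω ∂tauM = Z ω := fun ω => congrFun hZ ω
  have eG : ∀ s, ∫ t, X t s ∂tauM = G s := fun s => congrFun hG s
  simp only [eZ, eG] at *
  have hphiEq : ∫ ω, bphi h (Z ω) ∂P = ∫ s, bphi h (G s) ∂lamM := by
    have e1 : ∀ z, h z = bphi h z + (h 0 + deriv h 0 * z) := fun z => by unfold bphi; ring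
    have j1 : Integrable (fun ω => h 0 + deriv h 0 * Z ω) P :=
      (integrable_const _).add (hZi.const_mul _)
    have j2 : Integrable (fun s => h 0 + deriv h 0 * G s) lamM :=
      (integrable_const _).add (hGi.const_mul _)
    have a1 : ∫ ω, h (Z ω) ∂P = ∫ ω, bphi h (Z ω) ∂P + (h 0 + deriv h 0 * ∫ ω, Z ω ∂P) := by
      rw [integral_congr_ae (Eventually.of_forall fun ω => e1 (Z ω)), integral_add hZp j1,
        integral_add (integrable_const _) (hZi.const_mul _), integral_const_mul]
      simp
    have a2 : ∫ s, h (G s) ∂lamM =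
        ∫ s, bphi h (G s) ∂lamM + (h 0 + deriv h 0 * ∫ s, G s ∂lamM) := by
      rw [integral_congr_ae (Eventually.of_forall fun s => e1 (G s)), integral_add hGp j2,
        integral_add (integrable_const _) (hGi.const_mul _), integral_const_mul]
      simp
    rw [a1, a2, hEq] at heq
    linarith
  have t1 := bphi_tonelli hconv hs hZm hZi hZp
  have t2 := bphi_tonelli hconv hs hGm hGi hGp
  have hle : ∀ k, ∫ ω, Rk k (Z ω) ∂P ≤ ∫ s, Rk k (G s) ∂lamM := by
    intro k
    rw [(Rk_exp hZi k).2, (Rk_exp hGi k).2, hEq]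
    split_ifs
    · exact hSL k
    · linarith [hSL k]
  have hm2 : Measurable (fun k => ENNReal.ofReal (deriv (deriv h) k)) :=
    (second_deriv_cont hs).measurable.ennreal_ofReal
  have hmG : Measurable (fun k => ENNReal.ofReal (∫ s, Rk k (G s) ∂lamM)) := by
    refine Measurable.ennreal_ofReal ?_
    have : StronglyMeasurable (Function.uncurry fun k s => Rk k (G s)) :=
      (Rk_measurable.comp (measurable_fst.prodMk (hGm.comp measurable_snd))).stronglyMeasurable
    exact this.integral_prod_right.measurable
  have key := ae_eq_of_ae_le_of_lintegral_le (μ := (volume : Measure ℝ))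
    (f := fun k => ENNReal.ofReal (deriv (deriv h) k) * ENNReal.ofReal (∫ ω, Rk k (Z ω) ∂P))
    (g := fun k => ENNReal.ofReal (deriv (deriv h) k) * ENNReal.ofReal (∫ s, Rk k (G s) ∂lamM))
    (Eventually.of_forall fun k => mul_le_mul_right (ENNReal.ofReal_le_ofReal (hle k)) _)
    (by rw [← t1]; exact ENNReal.ofReal_ne_top) (hm2.mul hmG).aemeasurable
    (by rw [← t1, ← t2, hphiEq])
  filter_upwards [key] with k hk hpos
  have h1 : ENNReal.ofReal (∫ ω, Rk k (Z ω) ∂P) = ENNReal.ofReal (∫ s, Rk k (G s) ∂lamM) :=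
    (ENNReal.mul_right_inj (by simpa using hpos) ENNReal.ofReal_ne_top).1 hk
  have h2 : ∫ ω, Rk k (Z ω) ∂P = ∫ s, Rk k (G s) ∂lamM :=
    (ENNReal.ofReal_eq_ofReal_iff (integral_nonneg fun _ => Rk_nonneg _ _)
      (integral_nonneg fun _ => Rk_nonneg _ _)).1 h1
  rw [(Rk_exp hZi k).2, (Rk_exp hGi k).2, hEq] at h2
  split_ifs at h2
  · exact h2
  · linarith

end stopLoss

section finalPart

variable {Ω : Type*} [MeasurableSpace Ω] {μ : ℝ → Measure ℝ} {P : Measure Ω}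
  [IsProbabilityMeasure P] {Y : ℝ → Ω → ℝ} {X : ℝ → ℝ → ℝ} {h : ℝ → ℝ}
  [∀ t, IsProbabilityMeasure (μ t)]

lemma good_dense (hconv : StrictConvexOn ℝ Set.univ h) (hs : ContDiff ℝ 2 h) (hM : Moments μ h)
    (hX : IsProc μ lamM X) (hXm : ∀ t, StrictMonoOn (X t) (Ioo (0:ℝ) 1))
    (hXc : ∀ t, ContinuousOn (X t) (Ioo (0:ℝ) 1)) (hY : IsProc μ P Y)
    (heq : ∫ ω, h (∫ t, Y t ω ∂tauM) ∂P = ∫ s, h (∫ t, X t s ∂tauM) ∂lamM)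
    {p q : ℝ} (hp : 0 < p) (hpq : p < q) (hq : q < 1) :
    ∃ l ∈ Ioo p q, ∀ᵐ ω ∂P, (∀ t ∈ Icc (0:ℝ) 1, Y t ω ≤ X t l) ∨
      (∀ t ∈ Icc (0:ℝ) 1, X t l ≤ Y t ω) := by
  have hpI : p ∈ Ioo (0:ℝ) 1 := ⟨hp, hpq.trans hq⟩
  have hqI : q ∈ Ioo (0:ℝ) 1 := ⟨hp.trans hpq, hq⟩
  have hGm := G_strictMono hX hXm
  have hGc := G_cont hX hXm hXc
  have hlt := hGm hpI hqI hpq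
  have hpos := second_deriv_pos_somewhere hconv hs hlt
  have hae := SL_eq_ae hconv hs hM hX hXm hY heq
  have hex : ∃ k, (k ∈ Ioo (∫ t, X t p ∂tauM) (∫ t, X t q ∂tauM) ∩
      {k | 0 < deriv (deriv h) k}) ∧
      ∫ ω, max ((∫ t, Y t ω ∂tauM) - k) 0 ∂P =
        ∫ s, max ((∫ t, X t s ∂tauM) - k) 0 ∂lamM := by
    by_contra hne
    push Not at hne
    have : volume (Ioo (∫ t, X t p ∂tauM) (∫ t, X t q ∂tauM) ∩
      {k | 0 < deriv (deriv h) k}) = 0 := by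
      refine measure_mono_null (fun k hk => ?_) (ae_iff.1 hae)
      change ¬ _
      intro hh
      exact hne k hk (hh hk.2)
    exact hpos.ne' this
  obtain ⟨k, ⟨hk, -⟩, hke⟩ := hex
  have hsub : Icc p q ⊆ Ioo (0:ℝ) 1 := fun x hx => ⟨hp.trans_le hx.1, hx.2.trans_lt hq⟩
  obtain ⟨l, hl, hlk⟩ := intermediate_value_Ioo hpq.le (hGc.mono hsub) hk
  have hlI : l ∈ Ioo (0:ℝ) 1 := hsub (Ioo_subset_Icc_self hl)
  refine ⟨l, hl, ?_⟩
  change ∫ t, X t l ∂tauM = k at hlk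
  rw [← hlk, ← J_eq hconv hs hM hX hXm hY hlI] at hke
  have i1 : Integrable (fun ω => max ((∫ t, Y t ω ∂tauM) - ∫ t, X t l ∂tauM) 0) P :=
    ((hY.Z_int hconv hs hM).sub (integrable_const _)).pos_part
  have i2 : Integrable (fun ω => ∫ t, max (Y t ω - X t l) 0 ∂tauM) P :=
    (hY.J_prod hconv hs hM (hX.cont l)).integral_prod_right
  have h0 : ∫ ω, ((∫ t, max (Y t ω - X t l) 0 ∂tauM) -
      max ((∫ t, Y t ω ∂tauM) - ∫ t, X t l ∂tauM) 0) ∂P = 0 := by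
    rw [integral_sub i2 i1, hke, sub_self]
  rw [integral_eq_zero_iff_of_nonneg_ae (Eventually.of_forall fun ω => sub_nonneg.2
    (path_bound (hY.cont ω) (hX.cont l))) (i2.sub i1)] at h0
  filter_upwards [h0] with ω hω
  exact path_eq (hY.cont ω) (hX.cont l) (sub_eq_zero.1 hω).symm

lemma path_unique (hconv : StrictConvexOn ℝ Set.univ h) (hs : ContDiff ℝ 2 h) (hM : Moments μ h)
    (hX : IsProc μ lamM X) (hXm : ∀ t, StrictMonoOn (X t) (Ioo (0:ℝ) 1))
    (hXc : ∀ t, ContinuousOn (X t) (Ioo (0:ℝ) 1)) (hY : IsProc μ P Y)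
    (heq : ∫ ω, h (∫ t, Y t ω ∂tauM) ∂P = ∫ s, h (∫ t, X t s ∂tauM) ∂lamM) :
    ∀ᵐ ω ∂P, ∀ l ∈ Ioo (0:ℝ) 1, Y 0 ω = X 0 l → ∀ t ∈ Icc (0:ℝ) 1, Y t ω = X t l := by
  have hae : ∀ᵐ ω ∂P, ∀ p q : ℚ, (0:ℝ) < p → (p:ℝ) < q → (q:ℝ) < 1 → ∃ l ∈ Ioo (p:ℝ) q,
      (∀ t ∈ Icc (0:ℝ) 1, Y t ω ≤ X t l) ∨ (∀ t ∈ Icc (0:ℝ) 1, X t l ≤ Y t ω) := by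
    rw [ae_all_iff]; intro p
    rw [ae_all_iff]; intro q
    by_cases hc : (0:ℝ) < p ∧ (p:ℝ) < q ∧ (q:ℝ) < 1
    · obtain ⟨l, hl, hω⟩ := good_dense hconv hs hM hX hXm hXc hY heq hc.1 hc.2.1 hc.2.2
      filter_upwards [hω] with ω hω _ _ _
      exact ⟨l, hl, hω⟩
    · exact Eventually.of_forall fun ω h1 h2 h3 => absurd ⟨h1, h2, h3⟩ hc
  filter_upwards [hae] with ω hω l hl h0 t ht
  have hd : ∀ a b : ℝ, 0 < a → a < b → b < 1 → ∃ l ∈ Ioo a b,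
      (∀ t ∈ Icc (0:ℝ) 1, Y t ω ≤ X t l) ∨ (∀ t ∈ Icc (0:ℝ) 1, X t l ≤ Y t ω) := by
    intro a b ha hab hb
    obtain ⟨p, hp1, hp2⟩ := exists_rat_btwn hab
    obtain ⟨q, hq1, hq2⟩ := exists_rat_btwn hp2
    obtain ⟨l, hl, hh⟩ := hω p q (ha.trans hp1) hq1 (hq2.trans hb)
    exact ⟨l, ⟨hp1.trans hl.1, hl.2.trans hq2⟩, hh⟩
  have hcont : ContinuousAt (X t) l := (hXc t).continuousAt (isOpen_Ioo.mem_nhds hl)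
  refine le_antisymm ?_ ?_
  · by_contra hlt
    rw [not_le] at hlt
    have hev : ∀ᶠ s in nhds l, s ∈ Ioo (0:ℝ) 1 ∧ X t s < Y t ω :=
      Filter.Eventually.and (isOpen_Ioo.mem_nhds hl) (hcont.eventually (gt_mem_nhds hlt))
    obtain ⟨a, b, hab, hsub⟩ := mem_nhds_iff_exists_Ioo_subset.1 hev
    obtain ⟨c, hc1, hc2⟩ := exists_between hab.2
    have hc := hsub ⟨hab.1.trans hc1, hc2⟩
    obtain ⟨s, hs, hh⟩ := hd l c hl.1 hc1 hc.1.2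
    have hsI := hsub ⟨hab.1.trans hs.1, hs.2.trans hc2⟩
    rcases hh with hh | hh
    · exact absurd (hh t ht) (not_le.2 hsI.2)
    · have h1 := hh 0 (by simp)
      have h2 := hXm 0 hl hsI.1 hs.1
      linarith
  · by_contra hlt
    rw [not_le] at hlt
    have hev : ∀ᶠ s in nhds l, s ∈ Ioo (0:ℝ) 1 ∧ Y t ω < X t s :=
      Filter.Eventually.and (isOpen_Ioo.mem_nhds hl) (hcont.eventually (lt_mem_nhds hlt))
    obtain ⟨a, b, hab, hsub⟩ := mem_nhds_iff_exists_Ioo_subset.1 hev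
    obtain ⟨c, hc1, hc2⟩ := exists_between hab.1
    have hc := hsub ⟨hc1, hc2.trans hab.2⟩
    obtain ⟨s, hs, hh⟩ := hd c l hc.1.1 hc2 hl.2
    have hsI := hsub ⟨hc1.trans hs.1, hs.2.trans hab.2⟩
    rcases hh with hh | hh
    · have h1 := hh 0 (by simp)
      have h2 := hXm 0 hsI.1 hl hs.2
      linarith
    · exact absurd (hh t ht) (not_le.2 hsI.2)

lemma main_all [∀ t, NullSingletonClass (μ t)]
    (hsupp : ∀ t, (mSupport (μ t)).OrdConnected)
    (hweak : ∀ f : BoundedContinuousFunction ℝ ℝ, Continuous (fun t => ∫ x, f x ∂(μ t)))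
    (hconv : StrictConvexOn ℝ Set.univ h) (hs : ContDiff ℝ 2 h) (hM : Moments μ h)
    (hY : IsProc μ P Y)
    (heq : ∫ ω, h (∫ t, Y t ω ∂tauM) ∂P =
      ∫ l in Ioo (0:ℝ) 1, h (∫ t, mQuantile (μ t) l ∂tauM)) :
    (∀ᵐ ω ∂P, ∃ l ∈ Ioo (0:ℝ) 1, ∀ t ∈ Icc (0:ℝ) 1, Y t ω = mQuantile (μ t) l) ∧
    Measure.map (fun ω => fun t : Icc (0:ℝ) 1 => Y (t : ℝ) ω) P =
      Measure.map (fun l : ℝ => fun t : Icc (0:ℝ) 1 => mQuantile (μ (t : ℝ)) l)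
        ((volume : Measure ℝ).restrict (Ioo (0:ℝ) 1)) := by
  obtain ⟨X, hXdef⟩ : ∃ X : ℝ → ℝ → ℝ, X = fun t => (Ioo (0:ℝ) 1).indicator (mQuantile (μ t)) :=
    ⟨_, rfl⟩
  have hXq : ∀ t, ∀ l ∈ Ioo (0:ℝ) 1, X t l = mQuantile (μ t) l := by
    intro t l hl; rw [hXdef]; exact indicator_of_mem hl _
  have hXc : ∀ t, ContinuousOn (X t) (Ioo (0:ℝ) 1) := fun t =>
    (quantile_continuousOn (μ t) (hsupp t)).congr (hXq t)
  have hXm : ∀ t, StrictMonoOn (X t) (Ioo (0:ℝ) 1) := fun t =>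
    (quantile_strictMono (μ t)).congr (fun l hl => (hXq t l hl).symm)
  have hXmeas : ∀ t, Measurable (X t) := by
    intro t
    have := measurable_of_restrict_of_restrict_compl (f := X t) (measurableSet_Ioo (a := (0:ℝ)) (b := 1))
      ((continuousOn_iff_continuous_domRestrict.1 (hXc t)).measurable) ?_
    · exact this
    · have : (Ioo (0:ℝ) 1)ᶜ.domRestrict (X t) = fun _ => 0 := by
        funext l
        rw [hXdef]
        exact indicator_of_notMem l.2 _
      rw [this]; exact measurable_const
  have hX : IsProc μ lamM X := by
    refine ⟨fun l => ?_, hXmeas, fun t => quantile_map (μ t) (X t) (hXmeas t) (hXq t)⟩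
    by_cases hl : l ∈ Ioo (0:ℝ) 1
    · simp only [hXq _ l hl]
      exact quantile_continuous_time μ hsupp hweak hl
    · have : (fun t => X t l) = fun _ => 0 := by
        funext t; rw [hXdef]; exact indicator_of_notMem hl _
      rw [this]; exact continuous_const
  have heq' : ∫ ω, h (∫ t, Y t ω ∂tauM) ∂P = ∫ s, h (∫ t, X t s ∂tauM) ∂lamM := by
    rw [heq]
    refine setIntegral_congr_fun measurableSet_Ioo fun l hl => ?_
    simp only [hXq _ l hl]
  have hpath := path_unique hconv hs hM hX hXm hXc hY heq'
  have hFm : Measurable (mCdf (μ 0)) := (mCdf_continuous (μ 0)).measurable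
  have hSm : MeasurableSet {y : ℝ | mCdf (μ 0) y ∈ Ioo (0:ℝ) 1 ∧ y = X 0 (mCdf (μ 0) y)} :=
    (hFm measurableSet_Ioo).inter (measurableSet_eq_fun measurable_id ((hXmeas 0).comp hFm))
  have hFX : ∀ l ∈ Ioo (0:ℝ) 1, mCdf (μ 0) (X 0 l) = l := fun l hl => by
    rw [hXq 0 l hl, cdf_quantile (μ 0) hl]
  have hμ0 : ∀ᵐ y ∂(μ 0), mCdf (μ 0) y ∈ Ioo (0:ℝ) 1 ∧ y = X 0 (mCdf (μ 0) y) := by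
    have : ∀ᵐ y ∂(Measure.map (X 0) lamM), mCdf (μ 0) y ∈ Ioo (0:ℝ) 1 ∧
        y = X 0 (mCdf (μ 0) y) := by
      rw [ae_map_iff (hXmeas 0).aemeasurable hSm]
      refine (ae_restrict_iff' measurableSet_Ioo).2 (Eventually.of_forall fun l hl => ?_)
      rw [hFX l hl]; exact ⟨hl, rfl⟩
    rwa [hX.law 0] at this
  have hP0 : ∀ᵐ ω ∂P, mCdf (μ 0) (Y 0 ω) ∈ Ioo (0:ℝ) 1 ∧
      Y 0 ω = X 0 (mCdf (μ 0) (Y 0 ω)) := by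
    have h1 := hμ0
    rw [← hY.law 0] at h1
    have h2 := ae_of_ae_map (hY.meas 0).aemeasurable h1
    rwa [hY.law 0] at h2
  have hfin : ∀ᵐ ω ∂P, mCdf (μ 0) (Y 0 ω) ∈ Ioo (0:ℝ) 1 ∧
      ∀ t ∈ Icc (0:ℝ) 1, Y t ω = X t (mCdf (μ 0) (Y 0 ω)) := by
    filter_upwards [hpath, hP0] with ω h1 h2
    exact ⟨h2.1, h1 _ h2.1 h2.2⟩
  refine ⟨?_, ?_⟩
  · filter_upwards [hfin] with ω hω
    exact ⟨_, hω.1, fun t ht => by rw [← hXq t _ hω.1]; exact hω.2 t ht⟩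
  · have hLm : Measurable (fun ω => mCdf (μ 0) (Y 0 ω)) := hFm.comp (hY.meas 0)
    have hlaw : Measure.map (fun ω => mCdf (μ 0) (Y 0 ω)) P = lamM := by
      have e1 : Measure.map (fun ω => mCdf (μ 0) (Y 0 ω)) P =
          Measure.map (mCdf (μ 0)) (Measure.map (Y 0) P) :=
        (Measure.map_map hFm (hY.meas 0)).symm
      rw [e1, hY.law 0]
      have e2 : Measure.map (mCdf (μ 0)) (μ 0) = Measure.map (mCdf (μ 0) ∘ X 0) lamM := by
        rw [← Measure.map_map hFm (hXmeas 0), hX.law 0]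
      rw [e2]
      have e3 : mCdf (μ 0) ∘ X 0 =ᵐ[lamM] id :=
        (ae_restrict_iff' measurableSet_Ioo).2 (Eventually.of_forall fun l hl => hFX l hl)
      rw [Measure.map_congr e3, Measure.map_id]
    have hXpath : Measurable (fun l : ℝ => fun t : Icc (0:ℝ) 1 => X (t : ℝ) l) :=
      measurable_pi_lambda _ fun t => hXmeas t
    have e4 : (fun l : ℝ => fun t : Icc (0:ℝ) 1 => mQuantile (μ (t : ℝ)) l) =ᵐ[lamM]
        fun l : ℝ => fun t : Icc (0:ℝ) 1 => X (t : ℝ) l :=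
      (ae_restrict_iff' measurableSet_Ioo).2
        (Eventually.of_forall fun l hl => funext fun t => (hXq t l hl).symm)
    rw [Measure.map_congr e4, ← hlaw, Measure.map_map hXpath hLm]
    refine Measure.map_congr ?_
    filter_upwards [hfin] with ω hω
    funext t
    exact hω.2 t t.2

end finalPart

/-- Uniqueness of the maximizer: if `Y ∈ Π` attains the maximal value
`∫₀¹ h(∫₀¹ x_λ(t) dt) dλ` of `(MK_∞)`, then almost surely its sample path coincides on
`[0,1]` with `t ↦ x_λ(t)` for some `λ ∈ (0,1)`, and its law as a random continuous path
(recorded via its restriction to `[0,1]`) is the pushforward of Lebesgue measure on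
`(0,1)` under `λ ↦ x_λ(·)`, i.e. the law of `X^opt`. -/
theorem statement1
    (μ : ℝ → Measure ℝ) (h : ℝ → ℝ)
    -- assumption on marginals: probability measures
    (hprob : ∀ t ∈ Icc (0:ℝ) 1, IsProbabilityMeasure (μ t))
    -- assumption 1: h strictly convex and C²
    (hconv : StrictConvexOn ℝ Set.univ h)
    (hsmooth : ContDiff ℝ 2 h)
    -- assumption 2: absolute continuity
    (hac : ∀ t ∈ Icc (0:ℝ) 1, μ t ≪ (volume : Measure ℝ))
    -- assumption 3: the support of each μ_t is an interval
    (hsupp : ∀ t ∈ Icc (0:ℝ) 1, (mSupport (μ t)).OrdConnected)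
    -- assumption 4: weak continuity of t ↦ μ_t
    (hweak : ∀ f : BoundedContinuousFunction ℝ ℝ,
      ContinuousOn (fun t => ∫ x, f x ∂(μ t)) (Icc (0:ℝ) 1))
    -- assumption 5: first moments and h-moments exist and are integrable in t
    (hmom1 : ∀ t ∈ Icc (0:ℝ) 1, Integrable (fun x : ℝ => x) (μ t))
    (hmom1' : IntegrableOn (fun t => ∫ x, x ∂(μ t)) (Icc (0:ℝ) 1) volume)
    (hmomh : ∀ t ∈ Icc (0:ℝ) 1, Integrable h (μ t))
    (hmomh' : IntegrableOn (fun t => ∫ x, h x ∂(μ t)) (Icc (0:ℝ) 1) volume)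
    -- assumption 6: uniform convergence of Riemann sums of λ ↦ x_λ(·) on compacts of (0,1)
    (hriemann : ∀ K : Set ℝ, IsCompact K → K ⊆ Ioo (0:ℝ) 1 →
      TendstoUniformlyOn
        (fun (N : ℕ) (l : ℝ) =>
          (N : ℝ)⁻¹ * ∑ i ∈ Finset.Icc 1 N, mQuantile (μ ((i : ℝ) / (N : ℝ))) l)
        (fun l => ∫ t in (0:ℝ)..1, mQuantile (μ t) l) Filter.atTop K)
    {Ω : Type*} [MeasurableSpace Ω] (P : Measure Ω) [IsProbabilityMeasure P]
    (Y : ℝ → Ω → ℝ)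
    (hYcont : ∀ ω, ContinuousOn (fun t => Y t ω) (Icc (0:ℝ) 1))
    (hYmeas : ∀ t ∈ Icc (0:ℝ) 1, Measurable (Y t))
    (hYlaw : ∀ t ∈ Icc (0:ℝ) 1, Measure.map (Y t) P = μ t)
    (heq : ∫ ω, h (∫ t in (0:ℝ)..1, Y t ω) ∂P =
      ∫ l in Ioo (0:ℝ) 1, h (∫ t in (0:ℝ)..1, mQuantile (μ t) l)) :
    (∀ᵐ ω ∂P, ∃ l ∈ Ioo (0:ℝ) 1, ∀ t ∈ Icc (0:ℝ) 1, Y t ω = mQuantile (μ t) l) ∧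
    Measure.map (fun ω => fun t : Icc (0:ℝ) 1 => Y (t : ℝ) ω) P =
      Measure.map (fun l : ℝ => fun t : Icc (0:ℝ) 1 => mQuantile (μ (t : ℝ)) l)
        ((volume : Measure ℝ).restrict (Ioo (0:ℝ) 1)) := by
  let pr : ℝ → ℝ := fun t => (projIcc (0:ℝ) 1 zero_le_one t : ℝ)
  have prc : Continuous pr := continuous_subtype_val.comp continuous_projIcc
  have prm : ∀ t, pr t ∈ Icc (0:ℝ) 1 := fun t => (projIcc (0:ℝ) 1 zero_le_one t).2
  have pre : ∀ t ∈ Icc (0:ℝ) 1, pr t = t := fun t ht => by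
    simp only [pr, projIcc_of_mem zero_le_one ht]
  have inst1 : ∀ t, IsProbabilityMeasure ((fun t => μ (pr t)) t) := fun t => hprob _ (prm t)
  have inst2 : ∀ t, NullSingletonClass ((fun t => μ (pr t)) t) :=
    fun t => ⟨fun x => hac _ (prm t) (measure_singleton x)⟩
  have hint : ∀ f : ℝ → ℝ, ∫ t in (0:ℝ)..1, f t = ∫ t, f (pr t) ∂tauM := by
    intro f
    rw [intervalIntegral.integral_of_le zero_le_one, ← integral_Icc_eq_integral_Ioc]
    exact setIntegral_congr_fun measurableSet_Icc fun t ht => by simp only [pre t ht]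
  have hae : ∀ f : ℝ → ℝ, IntegrableOn f (Icc (0:ℝ) 1) volume →
      Integrable (fun t => f (pr t)) tauM := by
    intro f hf
    refine hf.congr ?_
    exact (ae_restrict_iff' measurableSet_Icc).2
      (Eventually.of_forall fun t ht => by simp only [pre t ht])
  have hM : Moments (fun t => μ (pr t)) h :=
    ⟨fun t => hmom1 _ (prm t), hae _ hmom1', fun t => hmomh _ (prm t), hae _ hmomh'⟩
  have hYp : IsProc (fun t => μ (pr t)) P (fun t => Y (pr t)) :=
    ⟨fun ω => (hYcont ω).comp_continuous prc prm, fun t => hYmeas _ (prm t),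
      fun t => hYlaw _ (prm t)⟩
  have key := main_all (μ := fun t => μ (pr t)) (Y := fun t => Y (pr t)) (P := P) (h := h)
    (fun t => hsupp _ (prm t)) (fun f => (hweak f).comp_continuous prc prm)
    hconv hsmooth hM hYp (by
      have e1 : ∀ ω, ∫ t in (0:ℝ)..1, Y t ω = ∫ t, Y (pr t) ω ∂tauM := fun ω =>
        hint (fun t => Y t ω)
      have e2 : ∀ l, ∫ t in (0:ℝ)..1, mQuantile (μ t) l = ∫ t, mQuantile (μ (pr t)) l ∂tauM :=
        fun l => hint (fun t => mQuantile (μ t) l)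
      simp only [e1, e2] at heq
      exact heq)
  refine ⟨?_, ?_⟩
  · filter_upwards [key.1] with ω hω
    obtain ⟨l, hl, hh⟩ := hω
    refine ⟨l, hl, fun t ht => ?_⟩
    have := hh t ht
    simpa only [pre t ht] using this
  · have := key.2
    have e : ∀ t : Icc (0:ℝ) 1, pr (t : ℝ) = t := fun t => pre t t.2
    simpa only [e] using this
end

section
/- Under assumptions 1–6, for each λ ∈ (0,1) the curve t ↦ x_λ(t) maximizes the functional F(x̃) = h(∫_0^1 x̃(t) dt) − ∫_0^1 G_t(x̃(t)) dt among all continuous curves x̃ : [0,1] → ℝ with x̃(t) ∈ (a_t, b_t) for all t; that is, for every such curve x̃, h(∫_0^1 x̃(t) dt) − ∫_0^1 G_t(x̃(t)) dt ≤ h(∫_0^1 x_λ(t) dt) − ∫_0^1 G_t(x_λ(t)) dt. -/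
open MeasureTheory Filter Set

/-- The function `g_t(x) = h'(∫₀¹ x_{F_t(x)}(r) dr)` from Section 2 of the paper. -/
noncomputable def gFun (μ : ℝ → Measure ℝ) (h : ℝ → ℝ) (t x : ℝ) : ℝ :=
  deriv h (∫ r in (0:ℝ)..1, mQuantile (μ r) (mCdf (μ t) x))

/-- The function `G_t(x) = ∫_{x_{1/2}(t)}^x g_t(y) dy` from Section 2 of the paper. -/
noncomputable def GFun (μ : ℝ → Measure ℝ) (h : ℝ → ℝ) (t x : ℝ) : ℝ :=
  ∫ y in (mQuantile (μ t) (1/2))..x, gFun μ h t y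


open ProbabilityTheory in
lemma aux_mCdf_eq (μ : Measure ℝ) [IsProbabilityMeasure μ] (x : ℝ) : mCdf μ x = cdf μ x := by
  rw [cdf_eq_real]; rfl

lemma aux_mono (μ : Measure ℝ) [IsProbabilityMeasure μ] : Monotone (mCdf μ) := by
  intro x y hxy
  rw [aux_mCdf_eq, aux_mCdf_eq]
  exact ProbabilityTheory.monotone_cdf μ hxy

open ProbabilityTheory in
lemma aux_cont (μ : Measure ℝ) [IsProbabilityMeasure μ] (hac : μ ≪ volume) :
    Continuous (mCdf μ) := by
  have : mCdf μ = fun x => cdf μ x := funext (aux_mCdf_eq μ)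
  rw [this, continuous_iff_continuousAt]
  intro x
  rw [(monotone_cdf μ).continuousAt_iff_leftLim_eq_rightLim, (cdf μ).rightLim_eq]
  have h0 : μ {x} = 0 := hac (by simp)
  rw [← measure_cdf μ, StieltjesFunction.measure_singleton] at h0
  have h1 := (monotone_cdf μ).leftLim_le (le_refl x)
  have h2 := ENNReal.ofReal_eq_zero.1 h0
  linarith

open ProbabilityTheory in
lemma aux_le_iff (μ : Measure ℝ) [IsProbabilityMeasure μ] (hac : μ ≪ volume)
    {l : ℝ} (hl : l ∈ Ioo (0:ℝ) 1) (x : ℝ) : mQuantile μ l ≤ x ↔ l ≤ mCdf μ x := by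
  have hbdd : BddBelow {x : ℝ | l ≤ mCdf μ x} := by
    have := (tendsto_cdf_atBot μ).eventually (gt_mem_nhds hl.1)
    obtain ⟨b, hb⟩ := this.exists
    refine ⟨b, fun y hy => ?_⟩
    by_contra hlt
    have h1 := aux_mono μ (not_le.1 hlt).le
    rw [aux_mCdf_eq μ b] at h1
    have h2 : l ≤ mCdf μ y := hy
    linarith
  have hne : {x : ℝ | l ≤ mCdf μ x}.Nonempty := by
    have := (tendsto_cdf_atTop μ).eventually (lt_mem_nhds hl.2)
    obtain ⟨b, hb⟩ := this.exists
    refine ⟨b, ?_⟩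
    show l ≤ mCdf μ b
    rw [aux_mCdf_eq μ b]
    exact hb.le
  have hcl : IsClosed {x : ℝ | l ≤ mCdf μ x} := isClosed_le continuous_const (aux_cont μ hac)
  have hmem := hcl.csInf_mem hne hbdd
  constructor
  · intro h
    exact le_trans hmem (aux_mono μ h)
  · intro h
    exact csInf_le hbdd h

lemma aux_cdf_quantile (μ : Measure ℝ) [IsProbabilityMeasure μ] (hac : μ ≪ volume)
    {l : ℝ} (hl : l ∈ Ioo (0:ℝ) 1) : mCdf μ (mQuantile μ l) = l := by
  apply le_antisymm
  · have hc := (aux_cont μ hac).continuousWithinAt (s := Iio (mQuantile μ l)) (x := mQuantile μ l)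
    refine le_of_tendsto hc ?_
    filter_upwards [self_mem_nhdsWithin] with y hy
    have : ¬ mQuantile μ l ≤ y := not_le.2 hy
    rw [aux_le_iff μ hac hl] at this
    exact (not_le.1 this).le
  · exact (aux_le_iff μ hac hl _).1 le_rfl

lemma aux_supp_eq (μ : Measure ℝ) : mSupport μ = μ.support := by
  ext x; rw [Measure.mem_support_iff_forall]; rfl

lemma aux_exists_supp (μ : Measure ℝ) (s : Set ℝ) (hs : μ s ≠ 0) : ∃ p ∈ s, p ∈ mSupport μ := by
  by_contra hcon
  push Not at hcon
  apply hs
  refine measure_mono_null (t := μ.supportᶜ) ?_ Measure.measure_compl_support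
  intro p hp
  rw [← aux_supp_eq]
  exact hcon p hp

lemma aux_strict (μ : Measure ℝ) [IsProbabilityMeasure μ]
    (hs : (mSupport μ).OrdConnected) {x y : ℝ} (hxy : x < y) (hx : 0 < mCdf μ x)
    (hy : mCdf μ y < 1) : mCdf μ x < mCdf μ y := by
  obtain ⟨p, hp, hps⟩ := aux_exists_supp μ (Iic x) (by
    intro h0; simp [mCdf, h0] at hx)
  obtain ⟨q, hq, hqs⟩ := aux_exists_supp μ (Iic y)ᶜ (by
    intro h0
    rw [prob_compl_eq_zero_iff measurableSet_Iic] at h0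
    simp [mCdf, h0] at hy)
  simp only [mem_Iic, mem_compl_iff, not_le] at hp hq
  have hm : (x + y) / 2 ∈ mSupport μ := hs.out hps hqs ⟨by linarith, by linarith⟩
  have hpos : 0 < μ (Ioo x y) := hm _ (Ioo_mem_nhds (by linarith) (by linarith))
  have h1 : μ (Iic x) + μ (Ioo x y) ≤ μ (Iic y) := by
    rw [← measure_union _ measurableSet_Ioo]
    · apply measure_mono
      rintro z (hz | hz)
      · exact le_trans hz hxy.le
      · exact hz.2.le
    · rw [Set.disjoint_left]
      intro z hz hz'
      exact absurd hz (not_le.2 hz'.1)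
  unfold mCdf
  rw [ENNReal.toReal_lt_toReal (measure_ne_top _ _) (measure_ne_top _ _)]
  exact lt_of_lt_of_le (ENNReal.lt_add_right (measure_ne_top _ _) hpos.ne') h1

lemma aux_lt_iff (μ : Measure ℝ) [IsProbabilityMeasure μ] (hac : μ ≪ volume)
    (hs : (mSupport μ).OrdConnected)
    {l : ℝ} (hl : l ∈ Ioo (0:ℝ) 1) (x : ℝ) : mQuantile μ l < x ↔ l < mCdf μ x := by
  have hq := aux_cdf_quantile μ hac hl
  constructor
  · intro h
    have h1 := aux_mono μ h.le
    rcases lt_or_ge (mCdf μ x) 1 with h2 | h2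
    · rw [← hq]
      exact aux_strict μ hs h (by rw [hq]; exact hl.1) h2
    · linarith [hl.2]
  · intro h
    by_contra hcon
    have h1 := aux_mono μ (not_lt.1 hcon)
    linarith

lemma aux_interior (μ : Measure ℝ) [IsProbabilityMeasure μ] {x : ℝ}
    (hx : x ∈ interior (mSupport μ)) : mCdf μ x ∈ Ioo (0:ℝ) 1 := by
  obtain ⟨e, he, hb⟩ := Metric.isOpen_iff.1 isOpen_interior x hx
  have hb' := hb.trans interior_subset
  have h1 : x - e/2 ∈ mSupport μ := hb' (by
    rw [Metric.mem_ball, Real.dist_eq, abs_lt]; constructor <;> linarith)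
  have h2 : x + e/2 ∈ mSupport μ := hb' (by
    rw [Metric.mem_ball, Real.dist_eq, abs_lt]; constructor <;> linarith)
  have h3 := h1 (Iic x) (Iic_mem_nhds (by linarith))
  have h4 := h2 (Iic x)ᶜ (by rw [compl_Iic]; exact Ioi_mem_nhds (by linarith))
  constructor
  · exact ENNReal.toReal_pos h3.ne' (measure_ne_top _ _)
  · have : μ (Iic x) < 1 := by
      refine lt_of_le_of_ne prob_le_one ?_
      intro h5
      rw [← prob_compl_eq_zero_iff measurableSet_Iic] at h5
      exact h4.ne' h5
    unfold mCdf
    rw [← ENNReal.toReal_one, ENNReal.toReal_lt_toReal (measure_ne_top _ _) ENNReal.one_ne_top]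
    exact this

open Topology in
lemma aux_weak (ν : ℝ → Measure ℝ) (hprob : ∀ t, IsProbabilityMeasure (ν t))
    (hac : ∀ t, ν t ≪ (volume : Measure ℝ))
    (hweak : ∀ f : BoundedContinuousFunction ℝ ℝ, Continuous (fun t => ∫ x, f x ∂(ν t)))
    (x : ℝ) : Continuous (fun t => mCdf (ν t) x) := by
  rw [continuous_iff_continuousAt]
  intro t
  let P : ℝ → ProbabilityMeasure ℝ := fun t => ⟨ν t, hprob t⟩
  have hP : Tendsto P (𝓝 t) (𝓝 (P t)) := by
    rw [ProbabilityMeasure.tendsto_iff_forall_integral_tendsto]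
    intro f
    exact (hweak f).tendsto t
  have h := ProbabilityMeasure.tendsto_measure_of_null_frontier_of_tendsto' hP (E := Iic x) (by
    rw [frontier_Iic]; exact hac t (by simp))
  have hne : (ν t) (Iic x) ≠ ⊤ := by
    have := hprob t
    exact measure_ne_top _ _
  exact (ENNReal.tendsto_toReal hne).comp h

/-- Regularity facts about a globally defined family of measures used in the core argument. -/
structure AuxFam (ν : ℝ → Measure ℝ) : Prop where
  mono : ∀ t, Monotone (mCdf (ν t))
  cont : ∀ t, Continuous (mCdf (ν t))
  contT : ∀ x, Continuous (fun t => mCdf (ν t) x)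
  le_iff : ∀ t, ∀ l ∈ Ioo (0:ℝ) 1, ∀ x, mQuantile (ν t) l ≤ x ↔ l ≤ mCdf (ν t) x
  lt_iff : ∀ t, ∀ l ∈ Ioo (0:ℝ) 1, ∀ x, mQuantile (ν t) l < x ↔ l < mCdf (ν t) x
  cdfQ : ∀ t, ∀ l ∈ Ioo (0:ℝ) 1, mCdf (ν t) (mQuantile (ν t) l) = l

namespace AuxFam

/-- The averaged quantile. -/
noncomputable def avg (ν : ℝ → Measure ℝ) (l : ℝ) : ℝ := ∫ r in (0:ℝ)..1, mQuantile (ν r) l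

variable {ν : ℝ → Measure ℝ} {h : ℝ → ℝ}

open Topology

lemma contF (H : AuxFam ν) {c : ℝ → ℝ} (hc : Continuous c) :
    Continuous (fun t => mCdf (ν t) (c t)) := by
  rw [continuous_iff_continuousAt]
  intro t
  have key : Tendsto (fun t => mCdf (ν t) (c t)) (𝓝 t) (𝓝 (mCdf (ν t) (c t))) := by
    rw [tendsto_order]
    constructor
    · intro a ha
      have h1 : ∀ᶠ y in 𝓝[<] (c t), a < mCdf (ν t) y :=
        ((H.cont t).continuousWithinAt.tendsto).eventually (lt_mem_nhds ha)
      obtain ⟨y, hy, hyc⟩ := (h1.and self_mem_nhdsWithin).exists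
      have h2 := ((H.contT y).tendsto t).eventually (lt_mem_nhds hy)
      have h3 := (hc.tendsto t).eventually (lt_mem_nhds (show y < c t from hyc))
      filter_upwards [h2, h3] with s hs hs'
      exact lt_of_lt_of_le hs (H.mono s hs'.le)
    · intro a ha
      have h1 : ∀ᶠ y in 𝓝[>] (c t), mCdf (ν t) y < a :=
        ((H.cont t).continuousWithinAt.tendsto).eventually (gt_mem_nhds ha)
      obtain ⟨y, hy, hyc⟩ := (h1.and self_mem_nhdsWithin).exists
      have h2 := ((H.contT y).tendsto t).eventually (gt_mem_nhds hy)
      have h3 := (hc.tendsto t).eventually (gt_mem_nhds (show c t < y from hyc))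
      filter_upwards [h2, h3] with s hs hs'
      exact lt_of_le_of_lt (H.mono s hs'.le) hs
  exact key

lemma Q_contT (H : AuxFam ν) {l : ℝ} (hl : l ∈ Ioo (0:ℝ) 1) :
    Continuous (fun t => mQuantile (ν t) l) := by
  rw [continuous_iff_continuousAt]
  intro t
  have key : Tendsto (fun t => mQuantile (ν t) l) (𝓝 t) (𝓝 (mQuantile (ν t) l)) := by
    rw [tendsto_order]
    constructor
    · intro a ha
      rw [← not_le, H.le_iff t l hl, not_le] at ha
      filter_upwards [((H.contT a).tendsto t).eventually (gt_mem_nhds ha)] with s hs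
      rwa [← not_le, H.le_iff s l hl, not_le]
    · intro a ha
      rw [gt_iff_lt, H.lt_iff t l hl] at ha
      filter_upwards [((H.contT a).tendsto t).eventually (lt_mem_nhds ha)] with s hs
      rwa [H.lt_iff s l hl]
  exact key

lemma Q_contL (H : AuxFam ν) (t : ℝ) {l : ℝ} (hl : l ∈ Ioo (0:ℝ) 1) :
    ContinuousAt (fun l => mQuantile (ν t) l) l := by
  have key : Tendsto (fun l => mQuantile (ν t) l) (𝓝 l) (𝓝 (mQuantile (ν t) l)) := by
    have hmem : ∀ᶠ s in 𝓝 l, s ∈ Ioo (0:ℝ) 1 := isOpen_Ioo.mem_nhds hl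
    rw [tendsto_order]
    constructor
    · intro a ha
      rw [← not_le, H.le_iff t l hl, not_le] at ha
      filter_upwards [lt_mem_nhds ha, hmem] with s hs hs'
      rwa [← not_le, H.le_iff t s hs', not_le]
    · intro a ha
      rw [gt_iff_lt, H.lt_iff t l hl] at ha
      filter_upwards [gt_mem_nhds ha, hmem] with s hs hs'
      rwa [H.lt_iff t s hs']
  exact key

lemma Q_mono (H : AuxFam ν) (t : ℝ) {l m : ℝ} (hl : l ∈ Ioo (0:ℝ) 1) (hm : m ∈ Ioo (0:ℝ) 1)
    (hlm : l ≤ m) : mQuantile (ν t) l ≤ mQuantile (ν t) m := by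
  rw [H.le_iff t l hl, H.cdfQ t m hm]; exact hlm

lemma Q_int (H : AuxFam ν) {l : ℝ} (hl : l ∈ Ioo (0:ℝ) 1) :
    IntervalIntegrable (fun t => mQuantile (ν t) l) volume 0 1 :=
  (H.Q_contT hl).intervalIntegrable _ _

lemma avg_mono (H : AuxFam ν) {l m : ℝ} (hl : l ∈ Ioo (0:ℝ) 1) (hm : m ∈ Ioo (0:ℝ) 1)
    (hlm : l ≤ m) : avg ν l ≤ avg ν m :=
  intervalIntegral.integral_mono_on zero_le_one (H.Q_int hl) (H.Q_int hm)
    (fun t _ => H.Q_mono t hl hm hlm)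

lemma avg_cont (H : AuxFam ν) {l : ℝ} (hl : l ∈ Ioo (0:ℝ) 1) : ContinuousAt (avg ν) l := by
  obtain ⟨a, ha0, hal⟩ := exists_between hl.1
  obtain ⟨b, hlb, hb1⟩ := exists_between hl.2
  have ha : a ∈ Ioo (0:ℝ) 1 := ⟨ha0, by linarith [hl.2]⟩
  have hb : b ∈ Ioo (0:ℝ) 1 := ⟨by linarith [hl.1], hb1⟩
  have hnear : ∀ᶠ s in 𝓝 l, s ∈ Ioo a b := isOpen_Ioo.mem_nhds ⟨hal, hlb⟩
  unfold avg
  apply intervalIntegral.continuousAt_of_dominated_interval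
    (bound := fun t => |mQuantile (ν t) a| + |mQuantile (ν t) b|)
  · filter_upwards [hnear] with s hs
    exact (H.Q_contT ⟨by linarith [hs.1], by linarith [hs.2]⟩).aestronglyMeasurable
  · filter_upwards [hnear] with s hs
    refine Eventually.of_forall fun t _ => ?_
    have hs' : s ∈ Ioo (0:ℝ) 1 := ⟨by linarith [hs.1], by linarith [hs.2]⟩
    have h1 := H.Q_mono t ha hs' hs.1.le
    have h2 := H.Q_mono t hs' hb hs.2.le
    rw [Real.norm_eq_abs, abs_le]
    constructor
    · linarith [neg_abs_le (mQuantile (ν t) a), abs_nonneg (mQuantile (ν t) b)]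
    · linarith [le_abs_self (mQuantile (ν t) b), abs_nonneg (mQuantile (ν t) a)]
  · exact (((H.Q_contT ha).abs).add ((H.Q_contT hb).abs)).intervalIntegrable _ _
  · exact Eventually.of_forall fun t _ => H.Q_contL t hl

lemma g_eq (t x : ℝ) : gFun ν h t x = deriv h (avg ν (mCdf (ν t) x)) := rfl

lemma between (H : AuxFam ν) {t p q y : ℝ} (hp : mCdf (ν t) p ∈ Ioo (0:ℝ) 1)
    (hq : mCdf (ν t) q ∈ Ioo (0:ℝ) 1) (hy : y ∈ uIcc p q) : mCdf (ν t) y ∈ Ioo (0:ℝ) 1 := by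
  rcases le_total p q with hpq | hpq
  · rw [uIcc_of_le hpq] at hy
    exact ⟨hp.1.trans_le (H.mono t hy.1), (H.mono t hy.2).trans_lt hq.2⟩
  · rw [uIcc_of_ge hpq] at hy
    exact ⟨hq.1.trans_le (H.mono t hy.1), (H.mono t hy.2).trans_lt hp.2⟩

lemma g_mono (H : AuxFam ν) (hd : Monotone (deriv h)) {t p q : ℝ}
    (hp : mCdf (ν t) p ∈ Ioo (0:ℝ) 1) (hq : mCdf (ν t) q ∈ Ioo (0:ℝ) 1) (hpq : p ≤ q) :
    gFun ν h t p ≤ gFun ν h t q :=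
  hd (H.avg_mono hp hq (H.mono t hpq))

lemma g_int (H : AuxFam ν) (hd : Monotone (deriv h)) {t p q : ℝ}
    (hp : mCdf (ν t) p ∈ Ioo (0:ℝ) 1) (hq : mCdf (ν t) q ∈ Ioo (0:ℝ) 1) :
    IntervalIntegrable (gFun ν h t) volume p q := by
  apply MonotoneOn.intervalIntegrable
  intro x hx y hy hxy
  exact H.g_mono hd (H.between hp hq hx) (H.between hp hq hy) hxy

lemma half_mem : (1/2 : ℝ) ∈ Ioo (0:ℝ) 1 := by constructor <;> norm_num

lemma Q_mem (H : AuxFam ν) (t : ℝ) {l : ℝ} (hl : l ∈ Ioo (0:ℝ) 1) :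
    mCdf (ν t) (mQuantile (ν t) l) ∈ Ioo (0:ℝ) 1 := by rwa [H.cdfQ t l hl]

lemma G_conv (H : AuxFam ν) (hd : Monotone (deriv h)) {t p q : ℝ}
    (hp : mCdf (ν t) p ∈ Ioo (0:ℝ) 1) (hq : mCdf (ν t) q ∈ Ioo (0:ℝ) 1) :
    gFun ν h t p * (q - p) ≤ GFun ν h t q - GFun ν h t p := by
  unfold GFun
  rw [intervalIntegral.integral_interval_sub_left (H.g_int hd (H.Q_mem t half_mem) hq)
    (H.g_int hd (H.Q_mem t half_mem) hp)]
  rcases le_total p q with hpq | hpq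
  · have h1 : ∫ y in p..q, gFun ν h t p ≤ ∫ y in p..q, gFun ν h t y := by
      apply intervalIntegral.integral_mono_on hpq (by simp) (H.g_int hd hp hq)
      intro y hy
      exact H.g_mono hd hp (H.between hp hq (by rwa [uIcc_of_le hpq])) hy.1
    rw [intervalIntegral.integral_const, smul_eq_mul] at h1
    linarith
  · have h1 : ∫ y in q..p, gFun ν h t y ≤ ∫ y in q..p, gFun ν h t p := by
      apply intervalIntegral.integral_mono_on hpq (H.g_int hd hq hp) (by simp)
      intro y hy
      exact H.g_mono hd (H.between hp hq (by rwa [uIcc_of_ge hpq])) hp hy.2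
    rw [intervalIntegral.integral_const, smul_eq_mul] at h1
    rw [intervalIntegral.integral_symm]
    linarith

lemma G_cont (H : AuxFam ν) (hd : Monotone (deriv h)) (hdc : Continuous (deriv h))
    {c : ℝ → ℝ} (hc : Continuous c) {a b : ℝ} (ha0 : 0 < a) (hb1 : b < 1)
    (hab : ∀ t, mCdf (ν t) (c t) ∈ Icc a b) : Continuous (fun t => GFun ν h t (c t)) := by
  set m : ℝ → ℝ := fun t => mQuantile (ν t) (1/2) with hm
  have hmc : Continuous m := H.Q_contT half_mem
  have hrep : ∀ t, GFun ν h t (c t) =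
      (c t - m t) * ∫ s in (0:ℝ)..1, gFun ν h t (m t + (c t - m t) * s) := by
    intro t
    have := intervalIntegral.smul_integral_comp_add_mul (a := 0) (b := 1) (gFun ν h t)
      (c t - m t) (m t)
    rw [smul_eq_mul] at this
    rw [this]
    unfold GFun
    congr 1 <;> ring
  have hfun : (fun t => GFun ν h t (c t)) = fun t =>
      (c t - m t) * ∫ s in (0:ℝ)..1, gFun ν h t (m t + (c t - m t) * s) := funext hrep
  rw [hfun]
  refine (hc.sub hmc).mul ?_
  set aLo := min a (1/2) with haLo
  set bHi := max b (1/2) with hbHi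
  have ha2 : aLo ≤ 1/2 := min_le_right _ _
  have hb2 : 1/2 ≤ bHi := le_max_right _ _
  have haLom : aLo ∈ Ioo (0:ℝ) 1 := ⟨lt_min ha0 (by norm_num), by linarith⟩
  have hbHim : bHi ∈ Ioo (0:ℝ) 1 := ⟨by linarith, max_lt hb1 (by norm_num)⟩
  have hrange : ∀ t, ∀ s ∈ Icc (0:ℝ) 1, mCdf (ν t) (m t + (c t - m t) * s) ∈ Icc aLo bHi := by
    intro t s hs
    have e1 : mCdf (ν t) (m t) = 1/2 := H.cdfQ t _ half_mem
    have h1 : min (m t) (c t) ≤ m t + (c t - m t) * s := by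
      rcases le_total (m t) (c t) with h | h
      · rw [min_eq_left h]; nlinarith [hs.1]
      · rw [min_eq_right h]; nlinarith [hs.2]
    have h2 : m t + (c t - m t) * s ≤ max (m t) (c t) := by
      rcases le_total (m t) (c t) with h | h
      · rw [max_eq_right h]; nlinarith [hs.2]
      · rw [max_eq_left h]; nlinarith [hs.1]
    have h3 := H.mono t h1
    have h4 := H.mono t h2
    rw [(H.mono t).map_min, e1] at h3
    rw [(H.mono t).map_max, e1] at h4
    constructor
    · refine le_trans ?_ h3
      exact le_min ha2 ((min_le_left _ _).trans (hab t).1)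
    · refine h4.trans ?_
      exact max_le hb2 ((hab t).2.trans (le_max_left _ _))
  have hsub : ∀ x ∈ Icc aLo bHi, x ∈ Ioo (0:ℝ) 1 := fun x hx =>
    ⟨haLom.1.trans_le hx.1, hx.2.trans_lt hbHim.2⟩
  rw [continuous_iff_continuousAt]
  intro t
  have hI : uIoc (0:ℝ) 1 ⊆ Icc 0 1 := by
    rw [uIoc_of_le zero_le_one]; exact Ioc_subset_Icc_self
  apply intervalIntegral.continuousAt_of_dominated_interval
    (bound := fun _ => |deriv h (avg ν aLo)| + |deriv h (avg ν bHi)|)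
  · refine Eventually.of_forall fun u => ?_
    apply ContinuousOn.aestronglyMeasurable _ measurableSet_uIoc
    intro s hs
    apply ContinuousAt.continuousWithinAt
    have h1 := H.avg_cont (hsub _ (hrange u s (hI hs)))
    have h2 : ContinuousAt (fun s => mCdf (ν u) (m u + (c u - m u) * s)) s :=
      ((H.cont u).comp (by fun_prop : Continuous fun s => m u + (c u - m u) * s)).continuousAt
    exact hdc.continuousAt.comp
      (ContinuousAt.comp (f := fun s => mCdf (ν u) (m u + (c u - m u) * s)) h1 h2)
  · refine Eventually.of_forall fun u => Eventually.of_forall fun s hs => ?_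
    have hr := hrange u s (hI hs)
    have h1 := hd (H.avg_mono haLom (hsub _ hr) hr.1)
    have h2 := hd (H.avg_mono (hsub _ hr) hbHim hr.2)
    rw [g_eq, Real.norm_eq_abs, abs_le]
    constructor
    · linarith [neg_abs_le (deriv h (avg ν aLo)), abs_nonneg (deriv h (avg ν bHi))]
    · linarith [le_abs_self (deriv h (avg ν bHi)), abs_nonneg (deriv h (avg ν aLo))]
  · simp
  · refine Eventually.of_forall fun s hs => ?_
    have h1 := H.avg_cont (hsub _ (hrange t s (hI hs)))
    have h2 : ContinuousAt (fun t => mCdf (ν t) (m t + (c t - m t) * s)) t :=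
      (H.contF (by fun_prop : Continuous fun t => m t + (c t - m t) * s)).continuousAt
    exact hdc.continuousAt.comp
      (ContinuousAt.comp (f := fun t => mCdf (ν t) (m t + (c t - m t) * s)) h1 h2)

lemma step (H : AuxFam ν) (hd : Monotone (deriv h)) (hdc : Continuous (deriv h))
    {c : ℝ → ℝ} (hc : Continuous c) {a b : ℝ} (ha0 : 0 < a) (hb1 : b < 1)
    (hab : ∀ t, mCdf (ν t) (c t) ∈ Icc a b) {l : ℝ} (hl : l ∈ Ioo (0:ℝ) 1) :
    deriv h (avg ν l) * ((∫ t in (0:ℝ)..1, c t) - avg ν l) ≤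
      (∫ t in (0:ℝ)..1, GFun ν h t (c t)) -
        ∫ t in (0:ℝ)..1, GFun ν h t (mQuantile (ν t) l) := by
  have i1 := (H.G_cont hd hdc hc ha0 hb1 hab).intervalIntegrable (μ := volume) 0 1
  have i2 := (H.G_cont (a := l) (b := l) hd hdc (H.Q_contT hl) hl.1 hl.2
    (fun t => by rw [H.cdfQ t l hl]; exact ⟨le_rfl, le_rfl⟩)).intervalIntegrable
      (μ := volume) 0 1
  have i3 := hc.intervalIntegrable (μ := volume) 0 1
  have i4 := H.Q_int hl
  rw [← intervalIntegral.integral_sub i1 i2]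
  unfold avg
  rw [← intervalIntegral.integral_sub i3 i4, ← intervalIntegral.integral_const_mul]
  apply intervalIntegral.integral_mono_on zero_le_one ((i3.sub i4).const_mul _) (i1.sub i2)
  intro t _
  have hct : mCdf (ν t) (c t) ∈ Ioo (0:ℝ) 1 :=
    ⟨ha0.trans_le (hab t).1, (hab t).2.trans_lt hb1⟩
  have := H.G_conv hd (h := h) (H.Q_mem t hl) hct
  rw [g_eq, H.cdfQ t l hl] at this
  exact this

/-- The functional along quantile curves. -/
noncomputable def phi (ν : ℝ → Measure ℝ) (h : ℝ → ℝ) (l : ℝ) : ℝ :=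
  h (avg ν l) - ∫ t in (0:ℝ)..1, GFun ν h t (mQuantile (ν t) l)

lemma phi_le (H : AuxFam ν) (hd : Monotone (deriv h)) (hdc : Continuous (deriv h))
    (htan : ∀ x y, h x + deriv h x * (y - x) ≤ h y)
    {l m : ℝ} (hl : l ∈ Ioo (0:ℝ) 1) (hm : m ∈ Ioo (0:ℝ) 1) :
    phi ν h m - phi ν h l ≤
      (deriv h (avg ν m) - deriv h (avg ν l)) * (avg ν m - avg ν l) := by
  have h1 := H.step hd hdc (H.Q_contT hm) hm.1 hm.2
    (fun t => by rw [H.cdfQ t m hm]; exact ⟨le_rfl, le_rfl⟩) hl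
  have h2 := htan (avg ν m) (avg ν l)
  change deriv h (avg ν l) * (avg ν m - avg ν l) ≤ _ at h1
  unfold phi
  linarith

lemma phi_abs (H : AuxFam ν) (hd : Monotone (deriv h)) (hdc : Continuous (deriv h))
    (htan : ∀ x y, h x + deriv h x * (y - x) ≤ h y)
    {l m : ℝ} (hl : l ∈ Ioo (0:ℝ) 1) (hm : m ∈ Ioo (0:ℝ) 1) :
    |phi ν h m - phi ν h l| ≤
      |deriv h (avg ν m) - deriv h (avg ν l)| * |avg ν m - avg ν l| := by
  rw [← abs_mul]
  refine le_trans ?_ (le_abs_self _)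
  rw [abs_le]
  have h1 := H.phi_le hd hdc htan hl hm
  have h2 := H.phi_le hd hdc htan hm hl
  constructor <;> linarith

lemma phi_const (H : AuxFam ν) (hd : Monotone (deriv h)) (hdc : Continuous (deriv h))
    (htan : ∀ x y, h x + deriv h x * (y - x) ≤ h y)
    {l m : ℝ} (hl : l ∈ Ioo (0:ℝ) 1) (hm : m ∈ Ioo (0:ℝ) 1) : phi ν h m = phi ν h l := by
  set J := avg ν '' Ioo (0:ℝ) 1 with hJ
  have hJc : Convex ℝ J := by
    rw [convex_iff_ordConnected]
    exact (isPreconnected_Ioo.image _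
      (fun x hx => (H.avg_cont hx).continuousWithinAt)).ordConnected
  have hch : ∀ s, ∃ k, s ∈ J → k ∈ Ioo (0:ℝ) 1 ∧ avg ν k = s := by
    intro s
    by_cases hs : s ∈ J
    · obtain ⟨k, hk, hks⟩ := hs
      exact ⟨k, fun _ => ⟨hk, hks⟩⟩
    · exact ⟨0, fun h => absurd h hs⟩
  choose κ hκ using hch
  set ψ : ℝ → ℝ := fun s => phi ν h (κ s) with hψ
  have hψb : ∀ s ∈ J, ∀ u ∈ J, |ψ u - ψ s| ≤ |deriv h u - deriv h s| * |u - s| := by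
    intro s hs u hu
    have := H.phi_abs hd hdc htan (hκ s hs).1 (hκ u hu).1
    rwa [(hκ s hs).2, (hκ u hu).2] at this
  have hder : ∀ s ∈ J, HasDerivWithinAt ψ 0 J s := by
    intro s hs
    rw [hasDerivWithinAt_iff_isLittleO, Asymptotics.isLittleO_iff]
    intro ε hε
    have h1 : ∀ᶠ u in 𝓝 s, |deriv h u - deriv h s| < ε := by
      have := Metric.tendsto_nhds.1 (hdc.tendsto s) ε hε
      simpa [Real.dist_eq] using this
    filter_upwards [mem_nhdsWithin_of_mem_nhds h1, self_mem_nhdsWithin] with u hu hu'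
    simp only [smul_zero, sub_zero, Real.norm_eq_abs]
    exact (hψb s hs u hu').trans (mul_le_mul_of_nonneg_right hu.le (abs_nonneg _))
  have hlJ : avg ν l ∈ J := mem_image_of_mem _ hl
  have hmJ : avg ν m ∈ J := mem_image_of_mem _ hm
  have h0 := hJc.norm_image_sub_le_of_norm_hasDerivWithin_le (C := 0) hder (by simp) hlJ hmJ
  have back : ∀ k ∈ Ioo (0:ℝ) 1, phi ν h k = ψ (avg ν k) := by
    intro k hk
    have hkJ : avg ν k ∈ J := mem_image_of_mem _ hk
    have := H.phi_abs hd hdc htan (hκ _ hkJ).1 hk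
    rw [(hκ _ hkJ).2, sub_self (avg ν k), abs_zero, mul_zero] at this
    exact sub_eq_zero.1 (abs_nonpos_iff.1 this)
  rw [back l hl, back m hm]
  rw [zero_mul] at h0
  exact sub_eq_zero.1 (norm_le_zero_iff.1 h0)

lemma main (H : AuxFam ν) (hd : Monotone (deriv h)) (hdc : Continuous (deriv h))
    (htan : ∀ x y, h x + deriv h x * (y - x) ≤ h y)
    {c : ℝ → ℝ} (hc : Continuous c) {a b : ℝ} (ha0 : 0 < a) (hb1 : b < 1)
    (hab : ∀ t, mCdf (ν t) (c t) ∈ Icc a b) {l : ℝ} (hl : l ∈ Ioo (0:ℝ) 1) :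
    h (∫ t in (0:ℝ)..1, c t) - ∫ t in (0:ℝ)..1, GFun ν h t (c t) ≤ phi ν h l := by
  have hab' : a ≤ b := (hab 0).1.trans (hab 0).2
  have ham : a ∈ Ioo (0:ℝ) 1 := ⟨ha0, by linarith⟩
  have hbm : b ∈ Ioo (0:ℝ) 1 := ⟨by linarith, hb1⟩
  have hi := hc.intervalIntegrable (μ := volume) 0 1
  have h1 : avg ν a ≤ ∫ t in (0:ℝ)..1, c t :=
    intervalIntegral.integral_mono_on zero_le_one (H.Q_int ham) hi
      (fun t _ => (H.le_iff t a ham _).2 (hab t).1)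
  have h2 : ∫ t in (0:ℝ)..1, c t ≤ avg ν b :=
    intervalIntegral.integral_mono_on zero_le_one hi (H.Q_int hbm)
      (fun t _ => by
        rw [← not_lt, H.lt_iff t b hbm, not_lt]
        exact (hab t).2)
  obtain ⟨k, hk, hke⟩ := intermediate_value_Icc hab'
    (fun x hx => (H.avg_cont (l := x)
      ⟨ha0.trans_le hx.1, hx.2.trans_lt hb1⟩).continuousWithinAt) ⟨h1, h2⟩
  have hkm : k ∈ Ioo (0:ℝ) 1 := ⟨ha0.trans_le hk.1, hk.2.trans_lt hb1⟩
  rw [H.phi_const hd hdc htan hkm hl]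
  have h3 := H.step hd hdc hc ha0 hb1 hab hkm
  rw [← hke, sub_self, mul_zero] at h3
  unfold phi
  rw [← hke]
  linarith

end AuxFam

lemma aux_tangent {h : ℝ → ℝ} (hconv : ConvexOn ℝ Set.univ h) (hdiff : Differentiable ℝ h)
    (x y : ℝ) : h x + deriv h x * (y - x) ≤ h y := by
  rcases lt_trichotomy x y with hxy | hxy | hxy
  · have := hconv.deriv_le_slope (mem_univ x) (mem_univ y) hxy (hdiff x)
    rw [slope_def_field, le_div_iff₀ (by linarith)] at this
    linarith
  · subst hxy; simp
  · have := hconv.slope_le_deriv (mem_univ y) (mem_univ x) hxy (hdiff x)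
    rw [slope_def_field, div_le_iff₀ (by linarith)] at this
    linarith

lemma aux_deriv_mono {h : ℝ → ℝ} (hconv : ConvexOn ℝ Set.univ h) (hdiff : Differentiable ℝ h) :
    Monotone (deriv h) := by
  intro x y hxy
  rcases hxy.eq_or_lt with rfl | hlt
  · exact le_rfl
  have h1 := aux_tangent hconv hdiff x y
  have h2 := aux_tangent hconv hdiff y x
  nlinarith

/-- Lemma 3.3 of the paper: for each `λ ∈ (0,1)` the quantile curve `t ↦ x_λ(t)`
maximizes `F(x̃) = h(∫₀¹ x̃(t) dt) − ∫₀¹ G_t(x̃(t)) dt` among continuous curves `x̃` with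
`x̃(t) ∈ (a_t, b_t)` (the interior of the support of `μ_t`) for all `t`. -/
theorem statement3
    (μ : ℝ → Measure ℝ) (h : ℝ → ℝ)
    -- assumption on marginals: probability measures
    (hprob : ∀ t ∈ Icc (0:ℝ) 1, IsProbabilityMeasure (μ t))
    -- assumption 1: h strictly convex and C²
    (hconv : StrictConvexOn ℝ Set.univ h)
    (hsmooth : ContDiff ℝ 2 h)
    -- assumption 2: absolute continuity
    (hac : ∀ t ∈ Icc (0:ℝ) 1, μ t ≪ (volume : Measure ℝ))
    -- assumption 3: the support of each μ_t is an interval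
    (hsupp : ∀ t ∈ Icc (0:ℝ) 1, (mSupport (μ t)).OrdConnected)
    -- assumption 4: weak continuity of t ↦ μ_t
    (hweak : ∀ f : BoundedContinuousFunction ℝ ℝ,
      ContinuousOn (fun t => ∫ x, f x ∂(μ t)) (Icc (0:ℝ) 1))
    -- assumption 5: first moments and h-moments exist and are integrable in t
    (hmom1 : ∀ t ∈ Icc (0:ℝ) 1, Integrable (fun x : ℝ => x) (μ t))
    (hmom1' : IntegrableOn (fun t => ∫ x, x ∂(μ t)) (Icc (0:ℝ) 1) volume)
    (hmomh : ∀ t ∈ Icc (0:ℝ) 1, Integrable h (μ t))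
    (hmomh' : IntegrableOn (fun t => ∫ x, h x ∂(μ t)) (Icc (0:ℝ) 1) volume)
    -- assumption 6: uniform convergence of Riemann sums of λ ↦ x_λ(·) on compacts of (0,1)
    (hriemann : ∀ K : Set ℝ, IsCompact K → K ⊆ Ioo (0:ℝ) 1 →
      TendstoUniformlyOn
        (fun (N : ℕ) (l : ℝ) =>
          (N : ℝ)⁻¹ * ∑ i ∈ Finset.Icc 1 N, mQuantile (μ ((i : ℝ) / (N : ℝ))) l)
        (fun l => ∫ t in (0:ℝ)..1, mQuantile (μ t) l) Filter.atTop K)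
    (l : ℝ) (hl : l ∈ Ioo (0:ℝ) 1)
    (xt : ℝ → ℝ)
    (hxtcont : ContinuousOn xt (Icc (0:ℝ) 1))
    (hxtmem : ∀ t ∈ Icc (0:ℝ) 1, xt t ∈ interior (mSupport (μ t))) :
    h (∫ t in (0:ℝ)..1, xt t) - ∫ t in (0:ℝ)..1, GFun μ h t (xt t) ≤
      h (∫ t in (0:ℝ)..1, mQuantile (μ t) l) -
        ∫ t in (0:ℝ)..1, GFun μ h t (mQuantile (μ t) l) := by
  classical
  let π : ℝ → ℝ := fun t => (projIcc (0:ℝ) 1 zero_le_one t : ℝ)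
  have hπm : ∀ t, π t ∈ Icc (0:ℝ) 1 := fun t => (projIcc (0:ℝ) 1 zero_le_one t).2
  have hπc : Continuous π := continuous_subtype_val.comp continuous_projIcc
  have hπe : ∀ t ∈ Icc (0:ℝ) 1, π t = t := fun t ht => by
    simp only [π, projIcc_of_mem zero_le_one ht]
  have hu : uIcc (0:ℝ) 1 = Icc 0 1 := uIcc_of_le zero_le_one
  let ν : ℝ → Measure ℝ := fun t => μ (π t)
  have hνe : ∀ t ∈ Icc (0:ℝ) 1, ν t = μ t := fun t ht => by simp only [ν, hπe t ht]
  have hνp : ∀ t, IsProbabilityMeasure (ν t) := fun t => hprob _ (hπm t)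
  have hνac : ∀ t, ν t ≪ (volume : Measure ℝ) := fun t => hac _ (hπm t)
  have hνs : ∀ t, (mSupport (ν t)).OrdConnected := fun t => hsupp _ (hπm t)
  have H : AuxFam ν :=
    { mono := fun t => by have := hνp t; exact aux_mono _
      cont := fun t => by have := hνp t; exact aux_cont _ (hνac t)
      contT := fun x => aux_weak ν hνp hνac
        (fun f => (hweak f).comp_continuous hπc hπm) x
      le_iff := fun t l hl x => by have := hνp t; exact aux_le_iff _ (hνac t) hl x
      lt_iff := fun t l hl x => by have := hνp t; exact aux_lt_iff _ (hνac t) (hνs t) hl x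
      cdfQ := fun t l hl => by have := hνp t; exact aux_cdf_quantile _ (hνac t) hl }
  have hdiff : Differentiable ℝ h := hsmooth.differentiable (by norm_num)
  have hdc : Continuous (deriv h) := hsmooth.continuous_deriv (by norm_num)
  have hd := aux_deriv_mono hconv.convexOn hdiff
  have htan := aux_tangent hconv.convexOn hdiff
  let c : ℝ → ℝ := fun t => xt (π t)
  have hc : Continuous c := hxtcont.comp_continuous hπc hπm
  have hce : ∀ t ∈ Icc (0:ℝ) 1, c t = xt t := fun t ht => by simp only [c, hπe t ht]
  have hcF := H.contF hc
  have hmem : ∀ t, mCdf (ν t) (c t) ∈ Ioo (0:ℝ) 1 := fun t => by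
    have := hνp t
    exact aux_interior _ (hxtmem _ (hπm t))
  have hππ : ∀ t, mCdf (ν t) (c t) = mCdf (ν (π t)) (c (π t)) := fun t => by
    simp only [ν, c, hπe _ (hπm t)]
  have hne : (Icc (0:ℝ) 1).Nonempty := nonempty_Icc.2 zero_le_one
  obtain ⟨t0, -, ht0⟩ := isCompact_Icc.exists_isMinOn hne hcF.continuousOn
  obtain ⟨t1, -, ht1⟩ := isCompact_Icc.exists_isMaxOn hne hcF.continuousOn
  have hfin := H.main hd hdc htan hc (hmem t0).1 (hmem t1).2
    (fun t => by rw [hππ t]; exact ⟨ht0 (hπm t), ht1 (hπm t)⟩) hl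
  have havg : ∀ k, AuxFam.avg ν k = ∫ r in (0:ℝ)..1, mQuantile (μ r) k := fun k => by
    apply intervalIntegral.integral_congr
    intro r hr
    rw [hu] at hr
    simp only [hνe r hr]
  have hG : ∀ t ∈ Icc (0:ℝ) 1, ∀ x, GFun ν h t x = GFun μ h t x := by
    intro t ht x
    unfold GFun
    rw [hνe t ht]
    have : gFun ν h t = gFun μ h t := by
      funext y
      rw [AuxFam.g_eq, havg, hνe t ht]
      rfl
    rw [this]
  have e1 : ∫ t in (0:ℝ)..1, c t = ∫ t in (0:ℝ)..1, xt t := by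
    apply intervalIntegral.integral_congr
    intro r hr
    rw [hu] at hr
    exact hce r hr
  have e2 : ∫ t in (0:ℝ)..1, GFun ν h t (c t) = ∫ t in (0:ℝ)..1, GFun μ h t (xt t) := by
    apply intervalIntegral.integral_congr
    intro r hr
    rw [hu] at hr
    simp only [hG r hr, hce r hr]
  have e3 : ∫ t in (0:ℝ)..1, GFun ν h t (mQuantile (ν t) l) =
      ∫ t in (0:ℝ)..1, GFun μ h t (mQuantile (μ t) l) := by
    apply intervalIntegral.integral_congr
    intro r hr
    rw [hu] at hr
    simp only [hG r hr, hνe r hr]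
  rw [e1, e2] at hfin
  unfold AuxFam.phi at hfin
  rw [e3, havg] at hfin
  exact hfin
end
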